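/- Let α<β_1<⋯<β_N and let φ:X→ℝ be the truncated potential of the finite construction (built from the subshifts X_1,…,X_{N+1} with constants c_1,…,c_{N+1}). Let μ_{N+1} denote the unique measure of maximal entropy of X_{N+1}. Then μ_{N+1} is the unique equilibrium state of βφ for all β>β_N. -/

import Mathlib

open MeasureTheory Real Filter Topology

noncomputable section

namespace PhaseTransitions

/-! ### Measure-theoretic entropy and topological pressure -/

/-- Base-2 entropy of the (finite, measurable) partition of `X` induced by an
observable `f : X → F` with finitely many values. -/
def entOfObs {X F : Type*} [MeasurableSpace X] [Fintype F]
    (μ : Measure X) (f : X → F) : ℝ :=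
  ∑ a : F, -((μ (f ⁻¹' {a})).toReal * Real.logb 2 (μ (f ⁻¹' {a})).toReal)

/-- Entropy of the transformation `T` with respect to the partition induced by
the observable `f` : the limit (= infimum) of `(1/n) H(⋁_{i<n} T⁻ⁱ f)`. -/
def entObsT {X F : Type*} [MeasurableSpace X] [Fintype F]
    (T : X → X) (μ : Measure X) (f : X → F) : ℝ :=
  ⨅ n : ℕ, entOfObs μ (fun x => fun i : Fin (n + 1) => f (T^[(i : ℕ)] x)) / (n + 1)

/-- Kolmogorov–Sinai (measure-theoretic) entropy, base 2: supremum over all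
finite measurable partitions (encoded by observables with values in `Fin k`). -/
def kolSinai {X : Type*} [MeasurableSpace X] (T : X → X) (μ : Measure X) : ℝ :=
  ⨆ k : ℕ, ⨆ f : {f : X → Fin k // Measurable f}, entObsT T μ f.1

/-- `μ` is a `T`-invariant Borel probability measure. -/
def InvProb {X : Type*} [MeasurableSpace X] (T : X → X) (μ : Measure X) : Prop :=
  IsProbabilityMeasure μ ∧ MeasurePreserving T μ μ

/-- Topological pressure, via the variational principle. -/
def pressure {X : Type*} [MeasurableSpace X] (T : X → X) (φ : X → ℝ) : ℝ :=
  ⨆ μ : {μ : Measure X // InvProb T μ}, (kolSinai T μ.1 + ∫ x, φ x ∂μ.1)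

/-- An equilibrium state of the potential `φ`: an invariant probability measure
attaining the supremum in the variational principle. -/
def IsEquilibrium {X : Type*} [MeasurableSpace X] (T : X → X) (φ : X → ℝ)
    (μ : Measure X) : Prop :=
  InvProb T μ ∧ kolSinai T μ + ∫ x, φ x ∂μ = pressure T φ

/-! ### The two-sided full shift on two symbols -/

/-- The two-sided full shift space `{0,1}^ℤ`. -/
abbrev Bin : Type := ℤ → Bool

/-- The (left) shift map. -/
def shift (x : Bin) : Bin := fun n => x (n + 1)

/-- `x` is a bi-infinite free concatenation of words from `W`: there is a
bi-infinite increasing sequence of cut points, cofinal in both directions, such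
that consecutive cut points delimit words of `W`. -/
def IsFreeConcat (W : Set (List Bool)) (x : Bin) : Prop :=
  ∃ t : ℤ → ℤ, StrictMono t ∧ (∀ N : ℤ, ∃ k, N < t k) ∧ (∀ N : ℤ, ∃ k, t k < N) ∧
    ∀ k : ℤ, ∃ w ∈ W, t (k + 1) = t k + w.length ∧
      ∀ (i : ℕ) (h : i < w.length), x (t k + (i : ℤ)) = w.get ⟨i, h⟩

/-- The coded system generated by the word set `W`: the closure of the set of
free concatenations of words from `W`. -/
def codedSystem (W : Set (List Bool)) : Set Bin :=
  closure {x | IsFreeConcat W x}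

/-- The generating set `W_n = {0^{2^n-1}1, 1^{2^n-1}0}`. -/
def genWords (n : ℕ) : Set (List Bool) :=
  {List.replicate (2 ^ n - 1) false ++ [true], List.replicate (2 ^ n - 1) true ++ [false]}

/-- The subshift `X_n`, the coded system generated by `W_n`. -/
def Xsub (n : ℕ) : Set Bin := codedSystem (genWords n)

/-- The set of words of length `j` in the language of `Y ⊆ {0,1}^ℤ`. -/
def langWord (Y : Set Bin) (j : ℕ) : Set (Fin j → Bool) :=
  {w | ∃ x ∈ Y, ∀ i : Fin j, x ((i : ℕ) : ℤ) = w i}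

/-! ### The metric and the potential -/

open Classical in
/-- The metric `d(x,y) = 2^{-inf{|n| : x_n ≠ y_n}}` on the shift space. -/
def binDist (x y : Bin) : ℝ :=
  if x = y then 0
  else (1 / 2 : ℝ) ^ sInf {m : ℕ | ∃ i : ℤ, i.natAbs = m ∧ x i ≠ y i}

/-- Distance from a point to a set. -/
def distToSet (x : Bin) (S : Set Bin) : ℝ :=
  sInf ((fun y => binDist x y) '' S)

/-- `δ_j = (10 + 3 log₂ j)/(α j)`. -/
def deltaSeq (α : ℝ) (j : ℕ) : ℝ := (10 + 3 * Real.logb 2 j) / (α * j)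

/-- The drop `δ` as a function of the distance `r`: if `r = 2^{-j}` this equals
`δ_j = (10 + 3 log₂ j)/(α j)`, and `δ = 0` when `r = 0` (i.e. `δ_∞ = 0`). -/
def deltaOf (α : ℝ) (r : ℝ) : ℝ :=
  if r = 0 then 0
  else (10 + 3 * Real.logb 2 (-Real.logb 2 r)) / (α * (-Real.logb 2 r))

/-- `c_n = -∑_{j=n}^∞ 1/(2^{j+1} β_j)`. -/
def cseq (β : ℕ → ℝ) (n : ℕ) : ℝ :=
  -∑' k : ℕ, 1 / (2 ^ (n + k + 1) * β (n + k))

/-- `φ_n(x) = c_n − δ_j` when `dist(x, X_n) = 2^{-j}` (and `φ_n = c_n` on `X_n`). -/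
def phiN (α : ℝ) (c : ℕ → ℝ) (n : ℕ) (x : Bin) : ℝ :=
  c n - deltaOf α (distToSet x (Xsub n))

/-- The potential `φ = sup_{n ≥ 1} φ_n`. -/
def phi (α : ℝ) (c : ℕ → ℝ) (x : Bin) : ℝ :=
  ⨆ n : ℕ, phiN α c (n + 1) x

/-- The constants of the finite (truncated) construction:
`c_{n} = c_1 + ∑_{j=1}^{n-1} 1/(2^{j+1} β_j)`. -/
def cseqFin (c1 : ℝ) (β : ℕ → ℝ) (n : ℕ) : ℝ :=
  c1 + ∑ j ∈ Finset.Ico 1 n, 1 / (2 ^ (j + 1) * β j)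

/-- The truncated potential `φ = max{φ_n : 1 ≤ n ≤ N+1}`. -/
def phiFin (α : ℝ) (c : ℕ → ℝ) (N : ℕ) (x : Bin) : ℝ :=
  ⨆ n : Fin (N + 1), phiN α c ((n : ℕ) + 1) x

/-! ### Measures of maximal entropy and relative pressure -/

/-- `μ` is a measure of maximal entropy for the subsystem `Y` (a `T`-invariant
probability measure giving full mass to `Y` and maximizing entropy among such). -/
def IsMaxEntropyOn (Y : Set Bin) (μ : Measure Bin) : Prop :=
  InvProb shift μ ∧ μ Y = 1 ∧
    ∀ ν : Measure Bin, InvProb shift ν → ν Y = 1 → kolSinai shift ν ≤ kolSinai shift μ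

/-- The topological pressure of the subsystem `Y` (computed via the variational
principle over invariant measures giving full mass to `Y`). -/
def pressureOn (Y : Set Bin) (φ : Bin → ℝ) : ℝ :=
  ⨆ μ : {μ : Measure Bin // InvProb shift μ ∧ μ Y = 1},
    (kolSinai shift μ.1 + ∫ x, φ x ∂μ.1)

/-! ### The pin-sequence space -/

/-- `Y`, the closure of the union of the `X_n`, `n ≥ 1`. -/
def Yset : Set Bin := closure (⋃ n : ℕ, Xsub (n + 1))

/-- The word `x_i ⋯ x_j` belongs to the language of `Y`. -/
def SegIn (x : Bin) (i j : ℤ) (Y : Set Bin) : Prop :=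
  ∃ y ∈ Y, ∀ m : ℤ, i ≤ m → m ≤ j → y (m - i) = x m

/-- The word `x_0 ⋯ x_{j-1}` belongs to the language of `Y`. -/
def WordIn (x : Bin) (j : ℕ) (Y : Set Bin) : Prop :=
  ∃ y ∈ Y, ∀ m : ℕ, m < j → y (m : ℤ) = x (m : ℤ)

/-- The pin-sequence space `P ⊆ X × {0,1}^ℤ`: pinless stretches of `x` lie in the
language of `Y`, and stretches between two pins do not. -/
def PinSpace : Set (Bin × Bin) :=
  {p | (∀ i j : ℤ, i < j → (∀ k : ℤ, i < k → k ≤ j → p.2 k = false) → SegIn p.1 i j Yset) ∧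
       (∀ i j : ℤ, i < j → p.2 i = true → p.2 j = true → ¬ SegIn p.1 i j Yset)}

/-- The product shift `T̄(x,z) = (Tx, Tz)`. -/
def shift2 (p : Bin × Bin) : Bin × Bin := (shift p.1, shift p.2)

/-- The set `A = {(x,z) ∈ P : z_0 = 1}`. -/
def Aset : Set (Bin × Bin) := {p | p ∈ PinSpace ∧ p.2 0 = true}

/-- The first return time to `A`. -/
def retTime (p : Bin × Bin) : ℕ :=
  sInf {k : ℕ | 1 ≤ k ∧ shift2^[k] p ∈ Aset}

/-- The induced (first-return) map `T̄_A`. -/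
def inducedMap (p : Bin × Bin) : Bin × Bin := shift2^[retTime p] p

/-- `Q_j`, the set of points of `A` with first return time `j`. -/
def Qset (j : ℕ) : Set (Bin × Bin) := {p | p ∈ Aset ∧ retTime p = j}

/-- `Q_{j,s}` for `1 ≤ s ≤ ⌊log₂ j⌋ - 3`: points of `Q_j` whose initial block of
length `j` lies in the language of `X_s`; the class `s = 0` collects the blocks
belonging to some `X_{s'}` with `s' ≥ ⌊log₂ j⌋ - 2`. -/
def Qjs (j s : ℕ) : Set (Bin × Bin) :=
  if s = 0 then
    {p | p ∈ Qset j ∧ ∃ s' : ℕ, 1 ≤ s' ∧ Nat.log 2 j - 2 ≤ s' ∧ WordIn p.1 j (Xsub s')}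
  else {p | p ∈ Qset j ∧ WordIn p.1 j (Xsub s)}

/-! ### Block sequences -/

/-- The sequence made of blocks of length `M` starting at the points of `t + Mℤ`, in which the
`k`-th block is the symbol `ω k` repeated `M - 1` times, followed by its negation. -/
def blk (M : ℕ) (t : ℤ) (ω : ℤ → Bool) : Bin :=
  fun p => xor (ω ((p - t) / M)) (decide ((p - t) % M = M - 1))

lemma genWord_get (n : ℕ) (b : Bool) (i : ℕ)
    (h : i < (List.replicate (2 ^ n - 1) b ++ [!b]).length) :
    (List.replicate (2 ^ n - 1) b ++ [!b]).get ⟨i, h⟩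
      = xor b (decide ((i : ℤ) = (2 ^ n : ℕ) - 1)) := by
  have hp : 1 ≤ 2 ^ n := Nat.one_le_two_pow
  simp only [List.length_append, List.length_replicate, List.length_singleton] at h
  simp only [List.get_eq_getElem]
  by_cases hi : i < 2 ^ n - 1
  · have : ¬ ((i : ℤ) = (2 ^ n : ℕ) - 1) := by omega
    rw [List.getElem_append_left (by simpa using hi), decide_eq_false this]
    simp
  · have : ((i : ℤ) = (2 ^ n : ℕ) - 1) := by omega
    rw [List.getElem_append_right (by simpa using hi), decide_eq_true this]
    simp

lemma genWord_length (n : ℕ) (b : Bool) :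
    (List.replicate (2 ^ n - 1) b ++ [!b]).length = 2 ^ n := by
  simp [Nat.sub_add_cancel Nat.one_le_two_pow]

lemma mem_genWords {n : ℕ} {w : List Bool} :
    w ∈ genWords n ↔ ∃ b, w = List.replicate (2 ^ n - 1) b ++ [!b] := by
  simp [genWords, Bool.exists_bool]

lemma isFreeConcat_blk (n : ℕ) (t : ℤ) (ω : ℤ → Bool) :
    IsFreeConcat (genWords n) (blk (2 ^ n) t ω) := by
  have hM : (0 : ℤ) < (2 ^ n : ℕ) := by positivity
  generalize hMM : 2 ^ n = M at *
  refine ⟨fun k => t + k * M, ?_, ?_, ?_, ?_⟩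
  · intro a b hab
    have := mul_lt_mul_of_pos_right hab hM
    simpa using this
  · intro N
    refine ⟨|N| + |t| + 1, ?_⟩
    have h1 := le_abs_self N
    have h2 := neg_abs_le t
    have h3 := abs_nonneg N
    have h4 := abs_nonneg t
    nlinarith
  · intro N
    refine ⟨-(|N| + |t| + 1), ?_⟩
    have h1 := neg_abs_le N
    have h2 := le_abs_self t
    have h3 := abs_nonneg N
    have h4 := abs_nonneg t
    nlinarith
  · intro k
    refine ⟨_, mem_genWords.2 ⟨ω k, rfl⟩, ?_, ?_⟩
    · rw [genWord_length, hMM]; ring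
    · intro i hi
      rw [genWord_get n (ω k) i hi, hMM]
      have hi' : (i : ℤ) < M := by rw [genWord_length, hMM] at hi; exact_mod_cast hi
      have e : t + k * M + i - t = i + k * M := by ring
      simp only [blk, e]
      rw [Int.add_mul_ediv_right _ _ hM.ne', Int.add_mul_emod_self_right,
        Int.ediv_eq_zero_of_lt (by positivity) hi', Int.emod_eq_of_lt (by positivity) hi']
      simp

lemma exists_blk_of_isFreeConcat {n : ℕ} {x : Bin} (hx : IsFreeConcat (genWords n) x) :
    ∃ t ω, x = blk (2 ^ n) t ω := by
  obtain ⟨t, -, -, -, h⟩ := hx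
  have hM : (0 : ℤ) < (2 ^ n : ℕ) := by positivity
  have h1 : ∀ k, t (k + 1) = t k + (2 ^ n : ℕ) := by
    intro k
    obtain ⟨w, hw, h1, -⟩ := h k
    obtain ⟨b, rfl⟩ := mem_genWords.1 hw
    rw [h1, genWord_length]
  have h2 : ∀ k, ∃ b : Bool, ∀ i : ℕ, i < 2 ^ n →
      x (t k + i) = xor b (decide ((i : ℤ) = (2 ^ n : ℕ) - 1)) := by
    intro k
    obtain ⟨w, hw, -, h2⟩ := h k
    obtain ⟨b, rfl⟩ := mem_genWords.1 hw
    exact ⟨b, fun i hi => by rw [h2 i (by rwa [genWord_length]), genWord_get]⟩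
  choose ω hω using h2
  generalize 2 ^ n = M at *
  have h3 : ∀ k, t k = t 0 + k * M := by
    intro k
    induction k using Int.induction_on with
    | zero => simp
    | succ i ih => rw [h1, ih]; ring
    | pred i ih =>
      have := h1 (-(i : ℤ) - 1)
      rw [sub_add_cancel, ih] at this
      linarith
  refine ⟨t 0, ω, funext fun p => ?_⟩
  have e1 := Int.emod_add_mul_ediv (p - t 0) M
  have e2 := Int.emod_nonneg (p - t 0) hM.ne'
  have e3 := Int.emod_lt_of_pos (p - t 0) hM
  have := hω ((p - t 0) / M) ((p - t 0) % M).toNat (by omega)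
  rw [h3, Int.toNat_of_nonneg e2] at this
  rw [blk, ← this]
  congr 1
  linarith

lemma isClosed_Xsub (n : ℕ) : IsClosed (Xsub n) := isClosed_closure

lemma blk_mem_Xsub (n : ℕ) (t : ℤ) (ω : ℤ → Bool) : blk (2 ^ n) t ω ∈ Xsub n :=
  subset_closure (isFreeConcat_blk n t ω)

/-- Points agreeing with `x` on a given finite window form a neighbourhood of `x`. -/
lemma eventually_agree (x : Bin) (s : Finset ℤ) : ∀ᶠ y in 𝓝 x, ∀ i ∈ s, y i = x i := by
  rw [Filter.eventually_all_finset]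
  intro i _
  exact (continuous_apply i).continuousAt.eventually_mem ((isOpen_discrete {x i}).mem_nhds rfl)

/-- Some point of `S` agrees with `x` on the window `[-r, r]`. -/
def Agree (S : Set Bin) (x : Bin) (r : ℕ) : Prop := ∃ y ∈ S, ∀ i : ℤ, i.natAbs ≤ r → y i = x i

/-- The word `x_0 ⋯ x_{ℓ-1}` is a subword of a block sequence of block length `M`. -/
def InLang (M ℓ : ℕ) (x : Bin) : Prop := ∃ t ω, ∀ p : ℤ, 0 ≤ p → p < ℓ → x p = blk M t ω p

lemma exists_blk_of_mem_Xsub {n : ℕ} {y : Bin} (hy : y ∈ Xsub n) (s : Finset ℤ) :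
    ∃ t ω, ∀ i ∈ s, blk (2 ^ n) t ω i = y i := by
  obtain ⟨z, hz, hz'⟩ :=
    ((mem_closure_iff_frequently.1 hy).and_eventually (eventually_agree y s)).exists
  obtain ⟨t, ω, rfl⟩ := exists_blk_of_isFreeConcat hz
  exact ⟨t, ω, hz'⟩

lemma agree_Xsub_iff {n : ℕ} {x : Bin} {r : ℕ} :
    Agree (Xsub n) x r ↔ ∃ t ω, ∀ i : ℤ, i.natAbs ≤ r → blk (2 ^ n) t ω i = x i := by
  constructor
  · rintro ⟨y, hy, h⟩
    obtain ⟨t, ω, h'⟩ := exists_blk_of_mem_Xsub hy (Finset.Icc (-r : ℤ) r)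
    refine ⟨t, ω, fun i hi => ?_⟩
    rw [h' i (by rw [Finset.mem_Icc]; omega), h i hi]
  · rintro ⟨t, ω, h⟩
    exact ⟨_, blk_mem_Xsub n t ω, h⟩

lemma mem_of_forall_agree {S : Set Bin} (hS : IsClosed S) {x : Bin} (h : ∀ r, Agree S x r) :
    x ∈ S := by
  choose y hy hyx using h
  refine hS.mem_of_tendsto (f := y) (b := atTop) ?_ (Eventually.of_forall hy)
  rw [tendsto_pi_nhds]
  intro i
  refine tendsto_const_nhds.congr' ?_
  filter_upwards [eventually_ge_atTop i.natAbs] with r hr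
  exact (hyx r i hr).symm

lemma blk_shift_const (M : ℕ) (b : Bool) (p : ℤ) : ∃ ω, blk M 0 ω p = b :=
  ⟨fun _ => xor b (decide ((p - 0) % M = M - 1)), by simp [blk]⟩

lemma agree_zero (n : ℕ) (x : Bin) : Agree (Xsub n) x 0 := by
  obtain ⟨ω, hω⟩ := blk_shift_const (2 ^ n) (x 0) 0
  refine agree_Xsub_iff.2 ⟨0, ω, fun i hi => ?_⟩
  obtain rfl : i = 0 := by omega
  exact hω

lemma inLang_one (M : ℕ) (x : Bin) : InLang M 1 x := by
  obtain ⟨ω, hω⟩ := blk_shift_const M (x 0) 0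
  refine ⟨0, ω, fun i h0 h1 => ?_⟩
  obtain rfl : i = 0 := by omega
  exact hω.symm

/-! ### The distance to a subshift -/

lemma binDist_nonneg (x y : Bin) : 0 ≤ binDist x y := by
  unfold binDist; split_ifs <;> positivity

lemma binDist_le {x y : Bin} {r : ℕ} (h : ∀ i : ℤ, i.natAbs < r → x i = y i) :
    binDist x y ≤ (1 / 2) ^ r := by
  unfold binDist
  split_ifs with hxy
  · positivity
  · refine pow_le_pow_of_le_one (by norm_num) (by norm_num) ?_
    obtain ⟨i, hi⟩ := Function.ne_iff.1 hxy
    refine le_csInf ⟨i.natAbs, i, rfl, hi⟩ ?_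
    rintro m ⟨j, rfl, hj⟩
    by_contra hlt
    exact hj (h j (by omega))

lemma le_binDist {x y : Bin} {r : ℕ} {i : ℤ} (hi : i.natAbs ≤ r) (h : x i ≠ y i) :
    (1 / 2) ^ r ≤ binDist x y := by
  unfold binDist
  rw [if_neg (fun e => h (by rw [e]))]
  refine pow_le_pow_of_le_one (by norm_num) (by norm_num) ?_
  have hmem : i.natAbs ∈ {m : ℕ | ∃ i : ℤ, i.natAbs = m ∧ x i ≠ y i} := ⟨i, rfl, h⟩
  exact (Nat.sInf_le hmem).trans hi

lemma bddBelow_binDist (x : Bin) (S : Set Bin) : BddBelow ((fun y => binDist x y) '' S) :=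
  ⟨0, by rintro _ ⟨y, -, rfl⟩; exact binDist_nonneg x y⟩

lemma distToSet_le {S : Set Bin} {x y : Bin} (hy : y ∈ S) : distToSet x S ≤ binDist x y :=
  csInf_le (bddBelow_binDist x S) ⟨y, hy, rfl⟩

lemma distToSet_eq_zero {S : Set Bin} {x : Bin} (h : x ∈ S) : distToSet x S = 0 := by
  refine le_antisymm ((distToSet_le h).trans (by simp [binDist])) ?_
  refine Real.sInf_nonneg ?_
  rintro _ ⟨y, -, rfl⟩
  exact binDist_nonneg x y

lemma distToSet_eq_pow {S : Set Bin} {x : Bin} {r : ℕ} (hr : ¬ Agree S x (r + 1))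
    (h : Agree S x r) : distToSet x S = (1 / 2) ^ (r + 1) := by
  obtain ⟨y, hy, hyx⟩ := h
  refine le_antisymm ((distToSet_le hy).trans (binDist_le fun i hi => (hyx i (by omega)).symm)) ?_
  refine le_csInf ⟨binDist x y, y, hy, rfl⟩ ?_
  rintro _ ⟨z, hz, rfl⟩
  simp only [Agree, not_exists, not_and, not_forall] at hr
  obtain ⟨i, hi, hne⟩ := hr z hz
  exact le_binDist hi (Ne.symm hne)

lemma deltaOf_pow (α : ℝ) (r : ℕ) : deltaOf α ((1 / 2) ^ r) = deltaSeq α r := by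
  have : Real.logb 2 ((1 / 2 : ℝ) ^ r) = -r := by
    rw [one_div, inv_pow, Real.logb_inv, Real.logb_pow, Real.logb_self_eq_one (by norm_num)]
    ring
  rw [deltaOf, if_neg (by positivity), this, neg_neg, deltaSeq]

/-- The value of `φ_n` at a point. -/
lemma phiN_cases (α : ℝ) (c : ℕ → ℝ) (n : ℕ) (x : Bin) :
    (x ∈ Xsub n ∧ phiN α c n x = c n) ∨
      ∃ r : ℕ, 1 ≤ r ∧ ¬ Agree (Xsub n) x r ∧ (∀ r' < r, Agree (Xsub n) x r') ∧
        phiN α c n x = c n - deltaSeq α r := by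
  classical
  by_cases h : ∀ r, Agree (Xsub n) x r
  · left
    have hx := mem_of_forall_agree (isClosed_Xsub n) h
    exact ⟨hx, by simp [phiN, distToSet_eq_zero hx, deltaOf]⟩
  · right
    push Not at h
    have h1 : 1 ≤ Nat.find h := by
      rw [Nat.one_le_iff_ne_zero]
      intro h0
      exact (h0 ▸ Nat.find_spec h) (agree_zero n x)
    obtain ⟨r, hr⟩ := Nat.exists_eq_add_of_le' h1
    have h2 : ∀ r' < Nat.find h, Agree (Xsub n) x r' := fun r' hr' => by
      simpa using Nat.find_min h hr'
    refine ⟨_, h1, Nat.find_spec h, h2, ?_⟩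
    have hs := Nat.find_spec h
    rw [hr] at hs ⊢
    rw [phiN, distToSet_eq_pow hs (h2 r (by omega)), deltaOf_pow]

/-! ### The drop sequence -/

/-- The function `(10 + 3 log₂ u) / u`. -/
def drop (u : ℝ) : ℝ := (10 + 3 * Real.logb 2 u) / u

lemma deltaSeq_eq (α : ℝ) (j : ℕ) : deltaSeq α j = drop j / α := by
  rw [deltaSeq, drop, div_div, mul_comm α]

lemma logb_two_le {t : ℝ} (ht : 1 ≤ t) : Real.logb 2 t ≤ 3 / 2 * (t - 1) := by
  have h1 := Real.log_le_sub_one_of_pos (zero_lt_one.trans_le ht)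
  have h2 := Real.log_two_gt_d9
  rw [Real.logb, div_le_iff₀ (by linarith)]
  nlinarith

lemma drop_anti {u v : ℝ} (hu : 1 ≤ u) (huv : u ≤ v) : drop v ≤ drop u := by
  have hu0 : 0 < u := by linarith
  have hv0 : 0 < v := by linarith
  have ht : 1 ≤ v / u := by rwa [le_div_iff₀ hu0, one_mul]
  have hl : 0 ≤ Real.logb 2 u := Real.logb_nonneg (by norm_num) hu
  have h1 : Real.logb 2 v = Real.logb 2 u + Real.logb 2 (v / u) := by
    rw [Real.logb_div hv0.ne' hu0.ne']; ring
  have h2 := logb_two_le ht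
  have h3 : u * Real.logb 2 (v / u) ≤ 3 / 2 * (v - u) := by
    calc u * Real.logb 2 (v / u) ≤ u * (3 / 2 * (v / u - 1)) := by gcongr
      _ = 3 / 2 * (v - u) := by field_simp
  rw [drop, drop, div_le_div_iff₀ hv0 hu0, h1]
  nlinarith [mul_nonneg hl (sub_nonneg.2 huv)]

lemma drop_pos {u : ℝ} (hu : 1 ≤ u) : 0 < drop u := by
  have := Real.logb_nonneg (b := 2) (by norm_num) hu
  unfold drop
  positivity

lemma drop_one : drop 1 = 10 := by simp [drop]

/-- The gap between the drops at the scales `2 * M + 1` and `5 * M` is at least `1 / M`. -/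
lemma inv_add_drop_le {M u : ℝ} (hM : 2 ≤ M) (hu : 5 * M ≤ u) :
    1 / M + drop u ≤ drop (2 * M + 1) := by
  have hM0 : 0 < M := by linarith
  have h1 : drop u ≤ drop (5 * M) := drop_anti (by linarith) hu
  have h2 : drop (5 / 2 * M) ≤ drop (2 * M + 1) := drop_anti (by linarith) (by linarith)
  have hL : 0 ≤ Real.logb 2 M := Real.logb_nonneg (by norm_num) (by linarith)
  have h3 : Real.logb 2 5 ≤ 3 := by
    rw [Real.logb_le_iff_le_rpow (by norm_num) (by norm_num)]; norm_num
  have h4 : 1 ≤ Real.logb 2 (5 / 2) := by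
    rw [Real.le_logb_iff_rpow_le (by norm_num) (by norm_num)]; norm_num
  refine le_trans ?_ h2
  refine le_trans (by gcongr) (?_ : 1 / M + drop (5 * M) ≤ _)
  rw [drop, drop, Real.logb_mul (by norm_num) hM0.ne', Real.logb_mul (by norm_num) hM0.ne']
  rw [show 1 / M + (10 + 3 * (Real.logb 2 5 + Real.logb 2 M)) / (5 * M)
    = (15 + 3 * (Real.logb 2 5 + Real.logb 2 M)) / (5 * M) by field_simp; ring]
  rw [show (10 + 3 * (Real.logb 2 (5 / 2) + Real.logb 2 M)) / (5 / 2 * M)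
    = (20 + 6 * (Real.logb 2 (5 / 2) + Real.logb 2 M)) / (5 * M) by field_simp; ring]
  gcongr ?_ / _
  linarith

/-! ### Common words of two coded systems -/

lemma blk_translate (M : ℕ) (t : ℤ) (ω : ℤ → Bool) (p k : ℤ) :
    blk M (t + k) ω (p + k) = blk M t ω p := by
  simp only [blk, add_sub_add_right_eq_sub]

/-- A block starts with a constant run of length `M - 1`. -/
lemma blk_const {M : ℕ} {t : ℤ} {ω : ℤ → Bool} {e i : ℤ} (he : (e - t) % M = 0)
    (h0 : 0 ≤ i) (hi : i + 1 < M) : blk M t ω (e + i) = blk M t ω e := by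
  have hM : (0 : ℤ) < M := by omega
  obtain ⟨k, hk⟩ := Int.dvd_of_emod_eq_zero he
  have e1 : e + i - t = i + k * M := by linarith
  have e2 : e - t = 0 + k * M := by linarith
  simp only [blk, e1, e2]
  rw [Int.add_mul_ediv_right _ _ hM.ne', Int.add_mul_emod_self_right,
    Int.add_mul_ediv_right _ _ hM.ne', Int.add_mul_emod_self_right,
    Int.ediv_eq_zero_of_lt h0 (by omega), Int.emod_eq_of_lt h0 (by omega), Int.zero_ediv,
    Int.zero_emod, decide_eq_false (by omega), decide_eq_false (by omega)]

/-- If two consecutive symbols differ then they are the last two of a block or lie in different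
blocks. -/
lemma emod_of_blk_ne {M : ℕ} (hM : 0 < M) {t : ℤ} {ω : ℤ → Bool} {p : ℤ}
    (h : blk M t ω p ≠ blk M t ω (p + 1)) :
    (p + 1 - t) % M = 0 ∨ (p + 2 - t) % M = 0 := by
  have hM' : (0 : ℤ) < M := by exact_mod_cast hM
  have h0 := Int.emod_nonneg (p - t) hM'.ne'
  have h1 := Int.emod_lt_of_pos (p - t) hM'
  have e := Int.emod_add_mul_ediv (p - t) M
  generalize hr : (p - t) % M = r at *
  generalize hq : (p - t) / M = q at *
  rcases lt_trichotomy (r + 1) M with hlt | heq | hgt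
  · rcases eq_or_ne (r + 2) M with h2 | h2
    · right
      have : p + 2 - t = M * (q + 1) := by linarith
      rw [this, Int.mul_emod_right]
    · exfalso
      have he : (p - r - t) % M = 0 := by
        rw [show p - r - t = M * q by linarith, Int.mul_emod_right]
      have c1 := blk_const (ω := ω) he h0 hlt
      have c2 := blk_const (ω := ω) (i := r + 1) he (by omega) (by omega)
      apply h
      rw [show p = p - r + r by ring, c1, show p - r + r + 1 = p - r + (r + 1) by ring, c2]
  · left
    have : p + 1 - t = M * (q + 1) := by linarith
    rw [this, Int.mul_emod_right]
  · omega

/-- Runs of equal symbols have length at most `M`. -/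
lemma exists_blk_ne {M : ℕ} (hM : 2 ≤ M) (t : ℤ) (ω : ℤ → Bool) (p : ℤ) :
    ∃ i : ℤ, 0 ≤ i ∧ i < M ∧ blk M t ω (p + i) ≠ blk M t ω (p + i + 1) := by
  have hM' : (0 : ℤ) < M := by omega
  have h0 := Int.emod_nonneg (p - t) hM'.ne'
  have h1 := Int.emod_lt_of_pos (p - t) hM'
  have e := Int.emod_add_mul_ediv (p - t) M
  generalize hr : (p - t) % M = r at *
  generalize hq : (p - t) / M = q at *
  have key : ∀ (i k : ℤ), p + i - t = (M - 2) + k * M →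
      blk M t ω (p + i) ≠ blk M t ω (p + i + 1) := by
    intro i k hk
    have e1 : p + i + 1 - t = (M - 1) + k * M := by linarith
    simp only [blk, e1, hk]
    rw [Int.add_mul_ediv_right _ _ hM'.ne', Int.add_mul_emod_self_right,
      Int.add_mul_ediv_right _ _ hM'.ne', Int.add_mul_emod_self_right,
      Int.ediv_eq_zero_of_lt (by omega) (by omega), Int.emod_eq_of_lt (by omega) (by omega),
      Int.ediv_eq_zero_of_lt (by omega) (by omega), Int.emod_eq_of_lt (by omega) (by omega),
      decide_eq_false (by omega), decide_eq_true rfl]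
    simp
  by_cases h : r + 1 < M
  · exact ⟨M - 2 - r, by omega, by omega, key _ q (by linarith)⟩
  · exact ⟨M - 1, by omega, by omega, key _ (q + 1) (by
      have : r = M - 1 := by omega
      subst this; linarith)⟩

/-- Words common to the systems of block lengths `M` and `M' ≥ 2 * M` have length at most
`2 * M + 1`. -/
lemma not_common_word {M M' : ℕ} (hM : 2 ≤ M) (hM' : 2 * M ≤ M') (t t' : ℤ) (ω ω' : ℤ → Bool)
    (a : ℤ) : ¬ ∀ i : ℤ, 0 ≤ i → i ≤ 2 * M + 1 → blk M t ω (a + i) = blk M' t' ω' (a + i) := by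
  intro h
  obtain ⟨i, hi0, hi1, hne⟩ := exists_blk_ne hM t ω a
  rw [h i hi0 (by omega), add_assoc, h (i + 1) (by omega) (by omega), ← add_assoc] at hne
  obtain ⟨e, he1, he2, he⟩ : ∃ e : ℤ, 0 ≤ e ∧ e ≤ M + 1 ∧ (a + e - t') % M' = 0 := by
    rcases emod_of_blk_ne (by omega) hne with h | h
    · exact ⟨i + 1, by omega, by omega, by rw [← h]; ring_nf⟩
    · exact ⟨i + 2, by omega, by omega, by rw [← h]; ring_nf⟩
  obtain ⟨j, hj0, hj1, hj⟩ := exists_blk_ne hM t ω (a + e)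
  apply hj
  rw [add_assoc a e j, h _ (by omega) (by omega), add_assoc a (e + j) 1,
    h _ (by omega) (by omega), ← add_assoc a e j, blk_const he hj0 (by omega),
    show a + (e + j + 1) = a + e + (j + 1) by ring, blk_const he (by omega) (by omega)]

/-! ### Estimates of the potential along a word -/

lemma shift_iterate_apply (k : ℕ) (x : Bin) (p : ℤ) : (shift^[k] x) p = x (p + k) := by
  induction k generalizing x with
  | zero => simp
  | succ k ih =>
    rw [Function.iterate_succ_apply, ih, shift]
    push_cast
    congr 1
    ring

lemma agree_of_mem {S : Set Bin} {x : Bin} (h : x ∈ S) (r : ℕ) : Agree S x r :=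
  ⟨x, h, fun _ _ => rfl⟩

lemma agree_shift_iff {n k r : ℕ} {x : Bin} :
    Agree (Xsub n) (shift^[k] x) r ↔
      ∃ t ω, ∀ i : ℤ, (i - k).natAbs ≤ r → blk (2 ^ n) t ω i = x i := by
  rw [agree_Xsub_iff]
  constructor
  · rintro ⟨t, ω, h⟩
    refine ⟨t + k, ω, fun i hi => ?_⟩
    have := h (i - k) hi
    rw [shift_iterate_apply, sub_add_cancel] at this
    rw [← this, ← blk_translate _ t ω (i - k) k, sub_add_cancel]
  · rintro ⟨t, ω, h⟩
    refine ⟨t - k, ω, fun i hi => ?_⟩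
    rw [shift_iterate_apply, ← h (i + k) (by simpa using hi), ← blk_translate _ (t - k) ω i k,
      sub_add_cancel]

lemma not_agree_of_not_inLang {n ℓ k : ℕ} {x : Bin} (h : ¬ InLang (2 ^ n) (ℓ + 1) x)
    (hk : k < ℓ) : ¬ Agree (Xsub n) (shift^[k] x) ℓ := by
  intro ha
  obtain ⟨t, ω, hω⟩ := agree_shift_iff.1 ha
  exact h ⟨t, ω, fun p h0 h1 => (hω p (by push_cast at h1; omega)).symm⟩

lemma not_agree_of_inLang {s n ℓ k : ℕ} {x : Bin} (hs : 1 ≤ s) (hsn : s < n)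
    (h : InLang (2 ^ s) ℓ x) (hℓ : 5 * 2 ^ s ≤ ℓ) (hk : k < ℓ) :
    ¬ Agree (Xsub n) (shift^[k] x) (2 * 2 ^ s + 1) := by
  intro ha
  obtain ⟨t', ω', h'⟩ := agree_shift_iff.1 ha
  obtain ⟨t, ω, hω⟩ := h
  have hM : 2 ≤ 2 ^ s := by
    calc 2 = 2 ^ 1 := rfl
      _ ≤ 2 ^ s := Nat.pow_le_pow_right (by norm_num) hs
  have hM' : 2 * 2 ^ s ≤ 2 ^ n := by
    rw [← pow_succ']; exact Nat.pow_le_pow_right (by norm_num) hsn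
  generalize 2 ^ s = M at *
  by_cases hc : k + (2 * M + 1) < ℓ
  · refine not_common_word hM hM' t t' ω ω' k fun i h0 h1 => ?_
    rw [← hω _ (by omega) (by omega), h' _ (by omega)]
  · refine not_common_word hM hM' t t' ω ω' (k - (2 * M + 1)) fun i h0 h1 => ?_
    rw [← hω _ (by omega) (by omega), h' _ (by omega)]

section Potential

variable {α : ℝ} {c : ℕ → ℝ}

lemma phiN_le_of_not_agree (hα : 0 < α) {n r : ℕ} {x : Bin} (h : ¬ Agree (Xsub n) x r) :
    phiN α c n x ≤ c n - drop r / α := by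
  rcases phiN_cases α c n x with ⟨hx, -⟩ | ⟨r', h1, h2, h3, h4⟩
  · exact absurd (agree_of_mem hx r) h
  · have hr : r' ≤ r := by
      by_contra hlt
      exact h (h3 r (by omega))
    rw [h4, deltaSeq_eq]
    have : drop r ≤ drop r' := drop_anti (by exact_mod_cast h1) (by exact_mod_cast hr)
    gcongr

lemma phiN_le (hα : 0 < α) (n : ℕ) (x : Bin) : phiN α c n x ≤ c n := by
  rcases phiN_cases α c n x with ⟨-, h⟩ | ⟨r, h1, -, -, h⟩
  · exact h.le
  · rw [h, deltaSeq_eq]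
    have := drop_pos (u := r) (by exact_mod_cast h1)
    have : 0 ≤ drop r / α := by positivity
    linarith

lemma phiN_lt (hα : 0 < α) {n : ℕ} {x : Bin} (hx : x ∉ Xsub n) : phiN α c n x < c n := by
  rcases phiN_cases α c n x with ⟨h, -⟩ | ⟨r, h1, -, -, h⟩
  · exact absurd h hx
  · rw [h, deltaSeq_eq]
    have := drop_pos (u := r) (by exact_mod_cast h1)
    have : 0 < drop r / α := by positivity
    linarith

lemma le_phiN (hα : 0 < α) (n : ℕ) (x : Bin) : c n - 10 / α ≤ phiN α c n x := by
  rcases phiN_cases α c n x with ⟨-, h⟩ | ⟨r, h1, -, -, h⟩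
  · rw [h]
    have : 0 ≤ 10 / α := by positivity
    linarith
  · rw [h, deltaSeq_eq, ← drop_one]
    have : drop r ≤ drop 1 := drop_anti le_rfl (by exact_mod_cast h1)
    gcongr

lemma phiN_of_mem {n : ℕ} {x : Bin} (hx : x ∈ Xsub n) : phiN α c n x = c n := by
  simp [phiN, distToSet_eq_zero hx, deltaOf]

lemma isOpen_binDist_lt (y : Bin) (a : ℝ) : IsOpen {x | binDist x y < a} := by
  rw [isOpen_iff_eventually]
  intro x hx
  have hx' : binDist x y < a := hx
  by_cases hxy : x = y
  · have ha : 0 < a := (binDist_nonneg x y).trans_lt hx'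
    obtain ⟨r, hr⟩ := exists_pow_lt_of_lt_one ha (by norm_num : (1 / 2 : ℝ) < 1)
    filter_upwards [eventually_agree x (Finset.Icc (-r : ℤ) r)] with z hz
    refine (binDist_le fun i hi => ?_).trans_lt hr
    rw [hz i (by rw [Finset.mem_Icc]; omega), hxy]
  · have hne : {m : ℕ | ∃ i : ℤ, i.natAbs = m ∧ x i ≠ y i}.Nonempty := by
      obtain ⟨i, hi⟩ := Function.ne_iff.1 hxy
      exact ⟨_, i, rfl, hi⟩
    obtain ⟨i, hi, hi'⟩ := Nat.sInf_mem hne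
    filter_upwards [eventually_agree x (Finset.Icc (-i.natAbs : ℤ) i.natAbs)] with z hz
    refine lt_of_le_of_lt ?_ hx'
    rw [show binDist x y = _ from if_neg hxy, ← hi]
    refine binDist_le fun j hj => ?_
    rw [hz j (by rw [Finset.mem_Icc]; omega)]
    by_contra hne'
    have hmem : j.natAbs ∈ {m : ℕ | ∃ i : ℤ, i.natAbs = m ∧ x i ≠ y i} := ⟨j, rfl, hne'⟩
    have := Nat.sInf_le hmem
    omega

lemma measurable_distToSet {S : Set Bin} (hS : S.Nonempty) :
    Measurable fun x => distToSet x S := by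
  refine measurable_of_Iio fun a => ?_
  have : (fun x => distToSet x S) ⁻¹' Set.Iio a = ⋃ y ∈ S, {x | binDist x y < a} := by
    ext x
    simp only [Set.mem_preimage, Set.mem_Iio, Set.mem_iUnion, Set.mem_ofPred_eq, exists_prop]
    rw [distToSet, csInf_lt_iff (bddBelow_binDist x S) (hS.image _)]
    simp
  rw [this]
  exact (isOpen_biUnion fun y _ => isOpen_binDist_lt y a).measurableSet

lemma measurable_deltaOf (α : ℝ) : Measurable (deltaOf α) := by
  unfold deltaOf Real.logb
  refine Measurable.ite (measurableSet_singleton 0) measurable_const ?_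
  fun_prop

lemma nonempty_Xsub (n : ℕ) : (Xsub n).Nonempty := ⟨_, blk_mem_Xsub n 0 fun _ => false⟩

lemma measurable_phiN (n : ℕ) : Measurable (phiN α c n) :=
  measurable_const.sub ((measurable_deltaOf α).comp (measurable_distToSet (nonempty_Xsub n)))

lemma measurable_phiFin (N : ℕ) : Measurable (phiFin α c N) :=
  Measurable.iSup fun _ => measurable_phiN _

lemma phiFin_le {N : ℕ} {x : Bin} {B : ℝ}
    (h : ∀ n, 1 ≤ n → n ≤ N + 1 → phiN α c n x ≤ B) : phiFin α c N x ≤ B :=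
  ciSup_le fun n => h _ (by omega) (by omega)

lemma phiN_le_phiFin {N n : ℕ} (h1 : 1 ≤ n) (hn : n ≤ N + 1) (x : Bin) :
    phiN α c n x ≤ phiFin α c N x := by
  obtain ⟨m, rfl⟩ := Nat.exists_eq_add_of_le' h1
  exact le_ciSup (f := fun n : Fin (N + 1) => phiN α c ((n : ℕ) + 1) x)
    (Set.finite_range _).bddAbove ⟨m, by omega⟩

/-- The potential along a word in the language of `X_s` that is long compared with `2^s`. -/
lemma phiFin_le_of_long {N s ℓ k : ℕ} {b P E : ℝ} {x : Bin} (hα : 0 < α) (hαb : α ≤ b)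
    (hc : ∀ m n, 1 ≤ m → m ≤ n → n ≤ N + 1 → c m ≤ c n)
    (hP : ∀ n, 1 ≤ n → n ≤ N + 1 → (1 / 2) ^ n + b * c n ≤ P)
    (hs : 1 ≤ s) (hsN : s ≤ N + 1) (hlong : 5 * 2 ^ s ≤ ℓ) (hk : k < ℓ)
    (hx : InLang (2 ^ s) ℓ x)
    (hE : E = 0 ∨ E = drop ℓ ∧ ∀ n, 1 ≤ n → n ≤ N + 1 → ¬ InLang (2 ^ n) (ℓ + 1) x) :
    b * phiFin α c N (shift^[k] x) ≤ P - E - (1 / 2) ^ s := by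
  have hb : 0 < b := hα.trans_le hαb
  rw [← le_div_iff₀' hb]
  refine phiFin_le fun n h1 hn => ?_
  rw [le_div_iff₀' hb]
  have hM : 2 ≤ 2 ^ s := by
    calc 2 = 2 ^ 1 := rfl
      _ ≤ 2 ^ s := Nat.pow_le_pow_right (by norm_num) hs
  have hℓ1 : (1 : ℝ) ≤ ℓ := by
    have : 1 ≤ ℓ := by omega
    exact_mod_cast this
  have scale : ∀ d : ℝ, 0 ≤ d → d ≤ b * (d / α) := by
    intro d hd
    rw [mul_div_assoc', le_div_iff₀ hα]
    nlinarith
  rcases le_or_gt n s with hns | hns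
  · have h2 : b * c n ≤ b * c s := mul_le_mul_of_nonneg_left (hc n s h1 hns hsN) hb.le
    have h3 := hP s hs hsN
    rcases hE with rfl | ⟨rfl, hE⟩
    · have := mul_le_mul_of_nonneg_left (phiN_le (c := c) hα n (shift^[k] x)) hb.le
      linarith
    · have h4 := mul_le_mul_of_nonneg_left (phiN_le_of_not_agree (c := c) hα
        (not_agree_of_not_inLang (hE n h1 hn) hk)) hb.le
      have := scale _ (drop_pos hℓ1).le
      linarith
  · have h4 := mul_le_mul_of_nonneg_left (phiN_le_of_not_agree (c := c) hα
        (not_agree_of_inLang hs hns hx hlong hk)) hb.le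
    have h5 := hP n h1 hn
    have h5' : (0 : ℝ) ≤ (1 / 2) ^ n := by positivity
    have h6 := inv_add_drop_le (M := 2 ^ s) (u := ℓ) (by exact_mod_cast hM)
      (by exact_mod_cast hlong)
    have h7 : E ≤ drop ℓ := by
      rcases hE with rfl | ⟨rfl, -⟩
      · exact (drop_pos hℓ1).le
      · exact le_rfl
    push_cast at h4
    have h8 := scale (drop (2 * 2 ^ s + 1)) (drop_pos (by
      have : (0 : ℝ) < 2 ^ s := by positivity
      linarith)).le
    rw [← one_div_pow] at h6
    linarith

/-- The potential along any word of the language. -/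
lemma phiFin_le_of_short {N ℓ k : ℕ} {b P E : ℝ} {x : Bin} (hα : 0 < α) (hαb : α ≤ b)
    (hP : ∀ n, 1 ≤ n → n ≤ N + 1 → (1 / 2) ^ n + b * c n ≤ P) (hk : k < ℓ)
    (hE : E = 0 ∨ E = drop ℓ ∧ ∀ n, 1 ≤ n → n ≤ N + 1 → ¬ InLang (2 ^ n) (ℓ + 1) x) :
    b * phiFin α c N (shift^[k] x) ≤ P - E := by
  have hb : 0 < b := hα.trans_le hαb
  rw [← le_div_iff₀' hb]
  refine phiFin_le fun n h1 hn => ?_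
  rw [le_div_iff₀' hb]
  have h3 := hP n h1 hn
  have h3' : (0 : ℝ) ≤ (1 / 2) ^ n := by positivity
  rcases hE with rfl | ⟨rfl, hE⟩
  · have := mul_le_mul_of_nonneg_left (phiN_le (c := c) hα n (shift^[k] x)) hb.le
    linarith
  · have h4 := mul_le_mul_of_nonneg_left (phiN_le_of_not_agree (c := c) hα
      (not_agree_of_not_inLang (hE n h1 hn) hk)) hb.le
    have hd : 0 < drop ℓ := drop_pos (by exact_mod_cast (by omega : 1 ≤ ℓ))
    have : drop ℓ ≤ b * (drop ℓ / α) := by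
      rw [mul_div_assoc', le_div_iff₀ hα]
      nlinarith
    linarith

end Potential

/-! ### Counting words -/

/-- The word `x_0 ⋯ x_{n-1}`. -/
def pre (n : ℕ) (x : Bin) : Fin n → Bool := fun i => x (i : ℕ)

/-- A point whose initial word is `w`. -/
def ext {n : ℕ} (w : Fin n → Bool) : Bin :=
  fun p => if h : p.toNat < n then w ⟨p.toNat, h⟩ else false

lemma pre_ext {n : ℕ} (w : Fin n → Bool) : pre n (ext w) = w := by
  funext i
  simp [pre, ext]

lemma pre_eq_iff {n : ℕ} {x y : Bin} :
    pre n x = pre n y ↔ ∀ p : ℤ, 0 ≤ p → p < n → x p = y p := by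
  constructor
  · intro h p h0 h1
    have := congrFun h ⟨p.toNat, by omega⟩
    simpa [pre, Int.toNat_of_nonneg h0] using this
  · intro h
    funext i
    exact h i (by positivity) (by exact_mod_cast i.2)

lemma ext_pre {n : ℕ} (x : Bin) {p : ℤ} (h0 : 0 ≤ p) (h1 : p < n) : ext (pre n x) p = x p :=
  pre_eq_iff.1 (pre_ext _) p h0 h1

lemma InLang.congr {M ℓ : ℕ} {x y : Bin} (h : InLang M ℓ x) (hxy : pre ℓ x = pre ℓ y) :
    InLang M ℓ y := by
  obtain ⟨t, ω, h⟩ := h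
  exact ⟨t, ω, fun p h0 h1 => by rw [← pre_eq_iff.1 hxy p h0 h1, h p h0 h1]⟩

open Classical in
lemma card_le_of_param {ι : Type*} [Fintype ι] {ℓ : ℕ} (Q : Bin → Prop) (e : ι → Bin)
    (h : ∀ x, Q x → ∃ i, ∀ p : ℤ, 0 ≤ p → p < ℓ → x p = e i p) :
    (Finset.univ.filter fun w : Fin ℓ → Bool => Q (ext w)).card ≤ Fintype.card ι := by
  calc _ ≤ (Finset.univ.image fun i => pre ℓ (e i)).card := by
        refine Finset.card_le_card fun w hw => ?_
        obtain ⟨i, hi⟩ := h _ (Finset.mem_filter.1 hw).2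
        refine Finset.mem_image.2 ⟨i, Finset.mem_univ _, ?_⟩
        rw [← pre_ext w]
        exact (pre_eq_iff.2 hi).symm
    _ ≤ _ := Finset.card_image_le

lemma blk_emod (M : ℕ) (t : ℤ) (ω : ℤ → Bool) :
    blk M t ω = blk M (t % M) fun j => ω (j - t / M) := by
  rcases Nat.eq_zero_or_pos M with rfl | hM
  · simp
  have hM' : (M : ℤ) ≠ 0 := by omega
  funext p
  have e : p - t % M = p - t + (t / M) * M := by
    have := Int.emod_add_mul_ediv t M
    linarith
  simp only [blk, e, Int.add_mul_ediv_right _ _ hM', Int.add_mul_emod_self_right,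
    add_sub_cancel_right]

open Classical in
lemma card_inLang_le {M : ℕ} (hM : 0 < M) (ℓ : ℕ) :
    (Finset.univ.filter fun w : Fin ℓ → Bool => InLang M ℓ (ext w)).card
      ≤ M * 2 ^ (ℓ / M + 2) := by
  have hM' : (0 : ℤ) < M := by exact_mod_cast hM
  have := card_le_of_param (ι := Fin M × (Fin (ℓ / M + 2) → Bool)) (ℓ := ℓ) (InLang M ℓ)
    (fun z => blk M (z.1 : ℕ) fun j => z.2 (Fin.ofNat _ (j + 1).toNat)) ?_
  · simpa using this
  · rintro x ⟨t, ω, h⟩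
    rw [blk_emod] at h
    have h0 := Int.emod_nonneg t hM'.ne'
    have h1 := Int.emod_lt_of_pos t hM'
    refine ⟨⟨⟨(t % M).toNat, by omega⟩, fun i => ω ((i : ℕ) - 1 - t / M)⟩, fun p hp0 hp1 => ?_⟩
    rw [h p hp0 hp1]
    simp only [blk, Int.toNat_of_nonneg h0, Fin.val_ofNat]
    have hd0 : -1 ≤ (p - t % M) / M := by
      rw [Int.le_ediv_iff_mul_le hM']; linarith
    have hd1 : (p - t % M) / M ≤ (ℓ : ℤ) / M := Int.ediv_le_ediv hM' (by linarith)
    have hd2 : ((ℓ / M : ℕ) : ℤ) = (ℓ : ℤ) / M := by push_cast; rfl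
    generalize (p - t % M) / M = d at *
    rw [Nat.mod_eq_of_lt (by omega), Int.toNat_of_nonneg (by omega), add_sub_cancel_right]

/-- The words of length `ℓ` that occur in block sequences whose blocks have length at least
`ℓ`. -/
def IsShort (ℓ : ℕ) (x : Bin) : Prop :=
  ∃ (q : Fin (ℓ + 2)) (a b : Bool), ∀ p : ℤ, 0 ≤ p → p < ℓ →
    x p = if p < (q : ℕ) then xor a (decide (p + 1 = (q : ℕ))) else b

lemma InLang.isShort {M ℓ : ℕ} {x : Bin} (h : InLang M ℓ x) (hℓ : 1 ≤ ℓ) (hM : ℓ ≤ M) :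
    IsShort ℓ x := by
  obtain ⟨t, ω, h⟩ := h
  have hM' : (0 : ℤ) < M := by omega
  have e := Int.emod_add_mul_ediv (t - 1) M
  have h0 := Int.emod_nonneg (t - 1) hM'.ne'
  have h1 := Int.emod_lt_of_pos (t - 1) hM'
  generalize (t - 1) / M = j at *
  generalize (t - 1) % M = r at *
  refine ⟨⟨min (r + 1).toNat (ℓ + 1), by omega⟩, ω (-j - 1), ω (-j), fun p hp0 hp1 => ?_⟩
  rw [h p hp0 hp1, blk]
  simp only
  split_ifs with hp
  · have e1 : p - t = (p - r - 1 + M) + (-j - 1) * M := by linarith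
    rw [e1, Int.add_mul_ediv_right _ _ hM'.ne', Int.add_mul_emod_self_right,
      Int.ediv_eq_zero_of_lt (by omega) (by omega), Int.emod_eq_of_lt (by omega) (by omega),
      zero_add]
    congr 1
    exact decide_eq_decide.2 (by omega)
  · have e1 : p - t = (p - r - 1) + (-j) * M := by linarith
    rw [e1, Int.add_mul_ediv_right _ _ hM'.ne', Int.add_mul_emod_self_right,
      Int.ediv_eq_zero_of_lt (by omega) (by omega), Int.emod_eq_of_lt (by omega) (by omega),
      zero_add, decide_eq_false (by omega), Bool.xor_false]

open Classical in
lemma card_isShort_le (ℓ : ℕ) :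
    (Finset.univ.filter fun w : Fin ℓ → Bool => IsShort ℓ (ext w)).card ≤ 4 * (ℓ + 2) := by
  have := card_le_of_param (ι := Fin (ℓ + 2) × Bool × Bool) (ℓ := ℓ) (IsShort ℓ)
    (fun z p => if p < (z.1 : ℕ) then xor z.2.1 (decide (p + 1 = (z.1 : ℕ))) else z.2.2) ?_
  · simp at this
    omega
  · rintro x ⟨q, a, b, h⟩
    exact ⟨(q, a, b), h⟩

/-! ### Weights of words -/

/-- The weight of a word of length `ℓ` in the language of `X_s`. -/
def langWeight (s ℓ : ℕ) : ℝ := if 5 * 2 ^ s ≤ ℓ then (2 : ℝ) ^ (-(ℓ : ℝ) / 2 ^ s) else 1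

lemma langWeight_nonneg (s ℓ : ℕ) : 0 ≤ langWeight s ℓ := by
  unfold langWeight; split_ifs <;> positivity

open Classical in
/-- A bound for the weight of a word of length `ℓ` in the languages of `X_1, …, X_{N+1}`. -/
def wordWeight (N ℓ : ℕ) (w : Fin ℓ → Bool) : ℝ :=
  (if IsShort ℓ (ext w) then 1 else 0) +
    ∑ s ∈ (Finset.Icc 1 (N + 1)).filter (fun s => 2 ^ s < ℓ),
      if InLang (2 ^ s) ℓ (ext w) then langWeight s ℓ else 0

lemma ite_langWeight_nonneg (s ℓ : ℕ) (p : Prop) [Decidable p] :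
    0 ≤ if p then langWeight s ℓ else 0 := by
  split_ifs
  · exact langWeight_nonneg s ℓ
  · exact le_rfl

lemma wordWeight_nonneg (N ℓ : ℕ) (w : Fin ℓ → Bool) : 0 ≤ wordWeight N ℓ w := by
  classical
  unfold wordWeight
  refine add_nonneg (by split_ifs <;> norm_num) (Finset.sum_nonneg fun s _ => ?_)
  exact ite_langWeight_nonneg s ℓ _

lemma card_mul_langWeight_le (s ℓ : ℕ) :
    ((2 ^ s * 2 ^ (ℓ / 2 ^ s + 2) : ℕ) : ℝ) * langWeight s ℓ ≤ 64 * 2 ^ s := by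
  have hM : 0 < 2 ^ s := by positivity
  unfold langWeight
  split_ifs with h
  · have h1 : ((2 ^ (ℓ / 2 ^ s) : ℕ) : ℝ) ≤ (2 : ℝ) ^ ((ℓ : ℝ) / 2 ^ s) := by
      push_cast
      rw [← Real.rpow_natCast]
      refine Real.rpow_le_rpow_of_exponent_le (by norm_num) ?_
      have := Nat.cast_div_le (α := ℝ) (m := ℓ) (n := 2 ^ s)
      exact_mod_cast this
    have h2 : (2 : ℝ) ^ ((ℓ : ℝ) / 2 ^ s) * (2 : ℝ) ^ (-(ℓ : ℝ) / 2 ^ s) = 1 := by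
      rw [← Real.rpow_add (by norm_num), neg_div, add_neg_cancel, Real.rpow_zero]
    have h3 : (0 : ℝ) < (2 : ℝ) ^ (-(ℓ : ℝ) / 2 ^ s) := by positivity
    have h4 := mul_le_mul_of_nonneg_right h1 h3.le
    rw [h2] at h4
    push_cast at h4 ⊢
    rw [pow_add]
    have h5 : (0 : ℝ) < 2 ^ s := by positivity
    nlinarith
  · have h1 : ℓ / 2 ^ s ≤ 4 := by
      have : ℓ / 2 ^ s < 5 := by rw [Nat.div_lt_iff_lt_mul hM]; omega
      omega
    have h2 : 2 ^ s * 2 ^ (ℓ / 2 ^ s + 2) ≤ 2 ^ s * 2 ^ 6 :=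
      Nat.mul_le_mul_left _ (Nat.pow_le_pow_right (by norm_num) (by omega))
    have h3 : ((2 ^ s * 2 ^ (ℓ / 2 ^ s + 2) : ℕ) : ℝ) ≤ ((2 ^ s * 2 ^ 6 : ℕ) : ℝ) := by
      exact_mod_cast h2
    push_cast at h3 ⊢
    linarith

lemma sum_two_pow_le (N ℓ : ℕ) (hℓ : 1 ≤ ℓ) :
    ∑ s ∈ (Finset.Icc 1 (N + 1)).filter (fun s => 2 ^ s < ℓ), (2 : ℝ) ^ s ≤ 2 * ℓ := by
  have h1 : ∑ s ∈ (Finset.Icc 1 (N + 1)).filter (fun s => 2 ^ s < ℓ), 2 ^ s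
      ≤ ∑ s ∈ Finset.range (Nat.log 2 ℓ + 1), 2 ^ s := by
    refine Finset.sum_le_sum_of_subset fun s hs => ?_
    rw [Finset.mem_range, Nat.lt_succ_iff]
    exact Nat.le_log_of_pow_le (by norm_num) (Finset.mem_filter.1 hs).2.le
  have h2 := Nat.geomSum_eq (le_refl 2) (Nat.log 2 ℓ + 1)
  have h3 : 2 ^ (Nat.log 2 ℓ) ≤ ℓ := Nat.pow_log_le_self 2 (by omega)
  have h4 : ∑ s ∈ (Finset.Icc 1 (N + 1)).filter (fun s => 2 ^ s < ℓ), 2 ^ s ≤ 2 * ℓ := by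
    rw [h2] at h1
    simp only [pow_succ] at h1
    omega
  exact_mod_cast h4

lemma sum_wordWeight_le (N : ℕ) {ℓ : ℕ} (hℓ : 1 ≤ ℓ) : ∑ w, wordWeight N ℓ w ≤ 140 * ℓ := by
  classical
  simp only [wordWeight, Finset.sum_add_distrib]
  rw [Finset.sum_comm]
  have h1 : ∑ w : Fin ℓ → Bool, (if IsShort ℓ (ext w) then (1 : ℝ) else 0) ≤ 12 * ℓ := by
    rw [Finset.sum_boole]
    have := card_isShort_le ℓ
    have h2 : (Finset.univ.filter fun w : Fin ℓ → Bool => IsShort ℓ (ext w)).card ≤ 12 * ℓ := by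
      omega
    exact_mod_cast h2
  have h2 : ∀ s, ∑ w : Fin ℓ → Bool, (if InLang (2 ^ s) ℓ (ext w) then langWeight s ℓ else 0)
      ≤ 64 * 2 ^ s := by
    intro s
    rw [← Finset.sum_filter, Finset.sum_const, nsmul_eq_mul]
    refine le_trans ?_ (card_mul_langWeight_le s ℓ)
    refine mul_le_mul_of_nonneg_right ?_ (langWeight_nonneg s ℓ)
    exact_mod_cast card_inLang_le (M := 2 ^ s) (by positivity) ℓ
  have h3 := Finset.sum_le_sum
    (s := (Finset.Icc 1 (N + 1)).filter (fun s => 2 ^ s < ℓ)) fun s _ => h2 s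
  rw [← Finset.mul_sum] at h3
  have h4 := sum_two_pow_le N ℓ hℓ
  refine (add_le_add h1 h3).trans ?_
  linarith

lemma exists_langWeight_le_wordWeight {N s ℓ : ℕ} {x : Bin} (hℓ : 1 ≤ ℓ) (hs : 1 ≤ s)
    (hsN : s ≤ N + 1) (h : InLang (2 ^ s) ℓ x) : langWeight s ℓ ≤ wordWeight N ℓ (pre ℓ x) := by
  classical
  have h' : InLang (2 ^ s) ℓ (ext (pre ℓ x)) := h.congr (pre_ext _).symm
  unfold wordWeight
  by_cases hlt : 2 ^ s < ℓ
  · have := Finset.single_le_sum (f := fun s =>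
      if InLang (2 ^ s) ℓ (ext (pre ℓ x)) then langWeight s ℓ else 0)
      (fun s _ => ite_langWeight_nonneg s ℓ _)
      (Finset.mem_filter (p := fun s => 2 ^ s < ℓ).2 ⟨Finset.mem_Icc.2 ⟨hs, hsN⟩, hlt⟩)
    simp only [if_pos h'] at this
    refine this.trans (le_add_of_nonneg_left ?_)
    split_ifs <;> norm_num
  · rw [if_pos (h'.isShort hℓ (by omega)), langWeight, if_neg (by omega)]
    exact le_add_of_nonneg_right (Finset.sum_nonneg fun s _ => ite_langWeight_nonneg s ℓ _)

lemma sum_mul_le {ℓ n : ℕ} (hℓ : ℓ ≤ n) {f : (Fin ℓ → Bool) → ℝ} {g : (Fin (n - ℓ) → Bool) → ℝ}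
    (hf : ∀ u, 0 ≤ f u) (hg : ∀ v, 0 ≤ g v) :
    ∑ w : Fin n → Bool, f (pre ℓ (ext w)) * g (pre (n - ℓ) (shift^[ℓ] (ext w)))
      ≤ (∑ u, f u) * ∑ v, g v := by
  classical
  have hinj : Function.Injective fun w : Fin n → Bool =>
      (pre ℓ (ext w), pre (n - ℓ) (shift^[ℓ] (ext w))) := by
    intro w w' h
    obtain ⟨h1, h2⟩ := Prod.mk.inj h
    rw [← pre_ext w, ← pre_ext w', pre_eq_iff]
    intro p h0 hp
    by_cases hpl : p < ℓ
    · exact pre_eq_iff.1 h1 p h0 hpl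
    · have := pre_eq_iff.1 h2 (p - ℓ) (by omega) (by omega)
      simpa [shift_iterate_apply] using this
  rw [Finset.sum_mul_sum, ← Finset.sum_product']
  rw [← Finset.sum_image (s := Finset.univ) (f := fun z => f z.1 * g z.2) hinj.injOn]
  exact Finset.sum_le_sum_of_subset_of_nonneg (Finset.subset_univ _)
    fun z _ _ => mul_nonneg (hf _) (hg _)

lemma sum_inv_sq_le (n : ℕ) : ∑ ℓ ∈ Finset.Ico 1 n, ((ℓ : ℝ) ^ 2)⁻¹ ≤ 2 := by
  rcases Nat.lt_or_ge n 3 with h | h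
  · interval_cases n <;> norm_num
  · have h1 := sum_Ioc_inv_sq_le_sub (α := ℝ) (k := 1) (n := n - 1) one_ne_zero (by omega)
    have h2 : Finset.Ico 1 n = insert 1 (Finset.Ioc 1 (n - 1)) := by
      ext; simp; omega
    rw [h2, Finset.sum_insert (by simp)]
    have h3 : (0 : ℝ) ≤ ((n - 1 : ℕ) : ℝ)⁻¹ := by positivity
    norm_num at h1 ⊢
    linarith

lemma two_rpow_neg_drop {ℓ : ℕ} (hℓ : 1 ≤ ℓ) :
    (2 : ℝ) ^ (-(ℓ * drop ℓ)) = ((ℓ : ℝ) ^ 3)⁻¹ / 1024 := by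
  have h0 : (0 : ℝ) < ℓ := by exact_mod_cast hℓ
  have h1 : -(ℓ * drop ℓ) = -10 + Real.logb 2 ℓ * (-3) := by
    unfold drop; field_simp; ring
  rw [h1, Real.rpow_add (by norm_num), Real.rpow_mul (by norm_num),
    Real.rpow_logb (by norm_num) (by norm_num) h0]
  rw [show (-10 : ℝ) = ((-10 : ℤ) : ℝ) by norm_num, Real.rpow_intCast,
    show (-3 : ℝ) = ((-3 : ℤ) : ℝ) by norm_num, Real.rpow_intCast, zpow_neg]
  norm_num [zpow_neg]
  ring_nf

/-! ### The partition function -/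

/-- The partition function of `ψ` over words of length `n` is at most `D * n`, with the Birkhoff
sums dominated by a function of the word. -/
def PartitionBound (ψ : Bin → ℝ) (D : ℝ) : Prop :=
  ∀ n : ℕ, 1 ≤ n → ∃ q : (Fin n → Bool) → ℝ,
    (∀ x, (2 : ℝ) ^ birkhoffSum shift ψ n x ≤ q (pre n x)) ∧ ∑ w, q w ≤ D * n

section Partition

variable {α b P : ℝ} {c : ℕ → ℝ} {N : ℕ}

lemma birkhoffSum_word_le {ℓ : ℕ} {x : Bin} {E : ℝ} (hα : 0 < α) (hαb : α ≤ b)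
    (hc : ∀ m n, 1 ≤ m → m ≤ n → n ≤ N + 1 → c m ≤ c n)
    (hP : ∀ n, 1 ≤ n → n ≤ N + 1 → (1 / 2) ^ n + b * c n ≤ P)
    (hℓ : 1 ≤ ℓ) (hx : ∃ s, 1 ≤ s ∧ s ≤ N + 1 ∧ InLang (2 ^ s) ℓ x)
    (hE : E = 0 ∨ E = drop ℓ ∧ ∀ n, 1 ≤ n → n ≤ N + 1 → ¬ InLang (2 ^ n) (ℓ + 1) x) :
    (2 : ℝ) ^ birkhoffSum shift (fun x => b * phiFin α c N x - P) ℓ x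
      ≤ (2 : ℝ) ^ (-(ℓ * E)) * wordWeight N ℓ (pre ℓ x) := by
  obtain ⟨s, hs, hsN, hx⟩ := hx
  refine le_trans ?_ (mul_le_mul_of_nonneg_left (exists_langWeight_le_wordWeight hℓ hs hsN hx)
    (by positivity))
  unfold langWeight
  split_ifs with hlong
  · rw [← Real.rpow_add (by norm_num)]
    refine Real.rpow_le_rpow_of_exponent_le (by norm_num) ?_
    have : ∀ k ∈ Finset.range ℓ,
        b * phiFin α c N (shift^[k] x) - P ≤ -E - (1 / 2) ^ s := fun k hk => by
      have := phiFin_le_of_long hα hαb hc hP hs hsN hlong (Finset.mem_range.1 hk) hx hE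
      linarith
    have := Finset.sum_le_sum this
    rw [Finset.sum_const, Finset.card_range, nsmul_eq_mul] at this
    refine this.trans (le_of_eq ?_)
    rw [one_div_pow]
    ring
  · rw [mul_one]
    refine Real.rpow_le_rpow_of_exponent_le (by norm_num) ?_
    have : ∀ k ∈ Finset.range ℓ, b * phiFin α c N (shift^[k] x) - P ≤ -E := fun k hk => by
      have := phiFin_le_of_short hα hαb hP (Finset.mem_range.1 hk) hE
      linarith
    have := Finset.sum_le_sum this
    rw [Finset.sum_const, Finset.card_range, nsmul_eq_mul] at this
    refine this.trans (le_of_eq ?_)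
    ring

/-- Decomposition of a word at the end of its longest initial word in the language. -/
lemma exists_longest_initial_word (N : ℕ) {n : ℕ} (hn : 1 ≤ n) (x : Bin) :
    ∃ ℓ, 1 ≤ ℓ ∧ ℓ ≤ n ∧ (∃ s, 1 ≤ s ∧ s ≤ N + 1 ∧ InLang (2 ^ s) ℓ x) ∧
      (ℓ < n → ∀ s, 1 ≤ s → s ≤ N + 1 → ¬ InLang (2 ^ s) (ℓ + 1) x) := by
  classical
  let p : ℕ → Prop := fun ℓ => 1 ≤ ℓ ∧ ∃ s, 1 ≤ s ∧ s ≤ N + 1 ∧ InLang (2 ^ s) ℓ x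
  have h1 : p 1 := ⟨le_rfl, 1, le_rfl, by omega, inLang_one _ _⟩
  have h2 := Nat.findGreatest_spec (P := p) hn h1
  refine ⟨Nat.findGreatest p n, h2.1, Nat.findGreatest_le n, h2.2, fun hlt s hs hsN h => ?_⟩
  have := Nat.findGreatest_is_greatest (P := p) (n := n) (Nat.lt_succ_self _) hlt
  exact this ⟨by omega, s, hs, hsN, h⟩

theorem partitionBound_phiFin (hα : 0 < α) (hαb : α ≤ b)
    (hc : ∀ m n, 1 ≤ m → m ≤ n → n ≤ N + 1 → c m ≤ c n)
    (hP : ∀ n, 1 ≤ n → n ≤ N + 1 → (1 / 2) ^ n + b * c n ≤ P) :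
    PartitionBound (fun x => b * phiFin α c N x - P) 300 := by
  intro n
  induction n using Nat.strong_induction_on with
  | _ n ih =>
  intro hn
  have ih' : ∀ ℓ : ℕ, ∃ q : (Fin (n - ℓ) → Bool) → ℝ, 1 ≤ ℓ → ℓ < n →
      (∀ x, (2 : ℝ) ^ birkhoffSum shift (fun x => b * phiFin α c N x - P) (n - ℓ) x
        ≤ q (pre (n - ℓ) x)) ∧ ∑ w, q w ≤ 300 * (n - ℓ : ℕ) := by
    intro ℓ
    by_cases h : 1 ≤ ℓ ∧ ℓ < n
    · obtain ⟨q, hq⟩ := ih (n - ℓ) (by omega) (by omega)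
      exact ⟨q, fun _ _ => hq⟩
    · exact ⟨0, fun h1 h2 => absurd ⟨h1, h2⟩ h⟩
  choose q hq using ih'
  have hq0 : ∀ ℓ, 1 ≤ ℓ → ℓ < n → ∀ v, 0 ≤ q ℓ v := by
    intro ℓ h1 h2 v
    have := (hq ℓ h1 h2).1 (ext v)
    rw [pre_ext] at this
    exact le_trans (by positivity) this
  let a : ∀ ℓ, (Fin ℓ → Bool) → ℝ := fun ℓ u => (2 : ℝ) ^ (-(ℓ * drop ℓ)) * wordWeight N ℓ u
  have ha0 : ∀ ℓ u, 0 ≤ a ℓ u := fun ℓ u =>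
    mul_nonneg (by positivity) (wordWeight_nonneg N ℓ u)
  refine ⟨fun w => ∑ ℓ ∈ Finset.Ico 1 n,
    a ℓ (pre ℓ (ext w)) * q ℓ (pre (n - ℓ) (shift^[ℓ] (ext w))) + wordWeight N n w, ?_, ?_⟩
  · intro x
    obtain ⟨ℓ, h1, h2, h3, h4⟩ := exists_longest_initial_word N hn x
    have hterm : ∀ ℓ ∈ Finset.Ico 1 n, 0 ≤ a ℓ (pre ℓ (ext (pre n x))) *
        q ℓ (pre (n - ℓ) (shift^[ℓ] (ext (pre n x)))) := fun ℓ hℓ =>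
      mul_nonneg (ha0 _ _) (hq0 ℓ (Finset.mem_Ico.1 hℓ).1 (Finset.mem_Ico.1 hℓ).2 _)
    rcases h2.eq_or_lt with rfl | hlt
    · have := birkhoffSum_word_le hα hαb hc hP h1 h3 (Or.inl rfl)
      rw [mul_zero, neg_zero, Real.rpow_zero, one_mul] at this
      exact this.trans (le_add_of_nonneg_left (Finset.sum_nonneg hterm))
    · refine le_trans ?_ (le_add_of_nonneg_right (wordWeight_nonneg N n _))
      refine le_trans ?_ (Finset.single_le_sum hterm (Finset.mem_Ico.2 ⟨h1, hlt⟩))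
      have e1 : pre ℓ (ext (pre n x)) = pre ℓ x :=
        pre_eq_iff.2 fun p h0 hp => ext_pre x h0 (by omega)
      have e2 : pre (n - ℓ) (shift^[ℓ] (ext (pre n x))) = pre (n - ℓ) (shift^[ℓ] x) := by
        refine pre_eq_iff.2 fun p h0 hp => ?_
        rw [shift_iterate_apply, shift_iterate_apply]
        exact ext_pre x (by omega) (by omega)
      rw [e1, e2]
      have hsplit : n = ℓ + (n - ℓ) := by omega
      rw [congrArg (fun m => birkhoffSum shift (fun x => b * phiFin α c N x - P) m x) hsplit,
        birkhoffSum_add, Real.rpow_add (by norm_num)]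
      exact mul_le_mul (birkhoffSum_word_le hα hαb hc hP h1 h3 (Or.inr ⟨rfl, h4 hlt⟩))
        ((hq ℓ h1 hlt).1 _) (by positivity) (ha0 _ _)
  · rw [Finset.sum_add_distrib, Finset.sum_comm]
    have hA : ∀ ℓ ∈ Finset.Ico 1 n, ∑ w : Fin n → Bool,
        a ℓ (pre ℓ (ext w)) * q ℓ (pre (n - ℓ) (shift^[ℓ] (ext w)))
          ≤ ((ℓ : ℝ) ^ 2)⁻¹ * (140 / 1024 * (300 * n)) := by
      intro ℓ hℓ
      obtain ⟨h1, h2⟩ := Finset.mem_Ico.1 hℓ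
      refine (sum_mul_le h2.le (ha0 ℓ) (hq0 ℓ h1 h2)).trans ?_
      have hs : ∑ u, a ℓ u ≤ ((ℓ : ℝ) ^ 2)⁻¹ * (140 / 1024) := by
        rw [← Finset.mul_sum, two_rpow_neg_drop h1]
        refine (mul_le_mul_of_nonneg_left (sum_wordWeight_le N h1) (by positivity)).trans
          (le_of_eq ?_)
        have : (ℓ : ℝ) ≠ 0 := by positivity
        field_simp
      have hs' : ∑ v, q ℓ v ≤ 300 * n := by
        refine (hq ℓ h1 h2).2.trans ?_
        have : ((n - ℓ : ℕ) : ℝ) ≤ n := by exact_mod_cast Nat.sub_le n ℓ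
        linarith
      rw [← mul_assoc]
      exact mul_le_mul hs hs' (Finset.sum_nonneg fun v _ => hq0 ℓ h1 h2 v) (by positivity)
    have h1 := Finset.sum_le_sum hA
    rw [← Finset.sum_mul] at h1
    have h2 := mul_le_mul_of_nonneg_right (sum_inv_sq_le n)
      (by positivity : (0 : ℝ) ≤ 140 / 1024 * (300 * n))
    have h3 := sum_wordWeight_le N hn
    have h4 : (0 : ℝ) ≤ n := by positivity
    linarith

end Partition

/-! ### The constants -/

lemma cseqFin_succ (c1 : ℝ) (β : ℕ → ℝ) {n : ℕ} (hn : 1 ≤ n) :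
    cseqFin c1 β (n + 1) = cseqFin c1 β n + 1 / (2 ^ (n + 1) * β n) := by
  rw [cseqFin, cseqFin, Finset.sum_Ico_succ_top hn]
  ring

lemma cseqFin_mono {c1 : ℝ} {β : ℕ → ℝ} {N : ℕ} (hβ : ∀ n, 1 ≤ n → n ≤ N → 0 < β n)
    (m n : ℕ) (hm : 1 ≤ m) (hmn : m ≤ n) (hn : n ≤ N + 1) :
    cseqFin c1 β m ≤ cseqFin c1 β n := by
  induction n, hmn using Nat.le_induction with
  | base => exact le_rfl
  | succ n hmn ih =>
    have hpos := hβ n (by omega) (by omega)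
    rw [cseqFin_succ c1 β (by omega)]
    have : 0 ≤ 1 / (2 ^ (n + 1) * β n) := by positivity
    linarith [ih (by omega)]

lemma cseqFin_lt {c1 : ℝ} {β : ℕ → ℝ} {N : ℕ} (hβ : ∀ n, 1 ≤ n → n ≤ N → 0 < β n)
    (m : ℕ) (hm : 1 ≤ m) (hmN : m ≤ N) : cseqFin c1 β m < cseqFin c1 β (N + 1) := by
  have hpos := hβ N (by omega) le_rfl
  have h := cseqFin_mono (c1 := c1) hβ m N hm hmN (by omega)
  rw [cseqFin_succ c1 β (by omega)]
  have : 0 < 1 / (2 ^ (N + 1) * β N) := by positivity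
  linarith

lemma cseqFin_pressure {c1 : ℝ} {β : ℕ → ℝ} {N : ℕ} {b : ℝ}
    (hβ : ∀ n, 1 ≤ n → n ≤ N → 0 < β n) (hb : ∀ n, 1 ≤ n → n ≤ N → β n ≤ b)
    (n : ℕ) (h1 : 1 ≤ n) (hn : n ≤ N + 1) :
    (1 / 2) ^ n + b * cseqFin c1 β n ≤ (1 / 2) ^ (N + 1) + b * cseqFin c1 β (N + 1) := by
  have key : ∀ m, n ≤ m → m ≤ N + 1 →
      (1 / 2) ^ n + b * cseqFin c1 β n ≤ (1 / 2) ^ m + b * cseqFin c1 β m := by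
    intro m hnm
    induction m, hnm using Nat.le_induction with
    | base => exact fun _ => le_rfl
    | succ m hnm ih =>
      intro hm
      have hpos := hβ m (by omega) (by omega)
      refine (ih (by omega)).trans ?_
      rw [cseqFin_succ c1 β (by omega), mul_add]
      have h2 : (1 / 2 : ℝ) ^ (m + 1) ≤ b * (1 / (2 ^ (m + 1) * β m)) := by
        rw [mul_one_div, one_div_pow, div_le_div_iff₀ (by positivity) (by positivity)]
        have := hb m (by omega) (by omega)
        have h3 : (0 : ℝ) < 2 ^ (m + 1) := by positivity
        nlinarith
      have h3 : (1 / 2 : ℝ) ^ m = 2 * (1 / 2) ^ (m + 1) := by rw [pow_succ]; ring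
      linarith
  exact key _ hn le_rfl

/-! ### Upper bounds for the entropy -/

section Entropy

variable {X F : Type*} [MeasurableSpace X] [Fintype F]

lemma entOfObs_nonneg (μ : Measure X) [IsProbabilityMeasure μ] (f : X → F) :
    0 ≤ entOfObs μ f := by
  refine Finset.sum_nonneg fun a _ => ?_
  rw [neg_nonneg]
  refine mul_nonpos_of_nonneg_of_nonpos ENNReal.toReal_nonneg ?_
  exact Real.logb_nonpos (by norm_num) ENNReal.toReal_nonneg (measureReal_le_one (μ := μ))

lemma entObsT_mul_le {μ : Measure X} [IsProbabilityMeasure μ] (T : X → X) (f : X → F) {n : ℕ}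
    (hn : 1 ≤ n) :
    n * entObsT T μ f ≤ entOfObs μ (fun x => fun i : Fin n => f (T^[(i : ℕ)] x)) := by
  obtain ⟨n, rfl⟩ : ∃ m, n = m + 1 := ⟨n - 1, by omega⟩
  have : entObsT T μ f ≤
      entOfObs μ (fun x => fun i : Fin (n + 1) => f (T^[(i : ℕ)] x)) / (n + 1) := by
    refine ciInf_le ⟨0, ?_⟩ n
    rintro _ ⟨m, rfl⟩
    exact div_nonneg (entOfObs_nonneg _ _) (by positivity)
  rw [le_div_iff₀ (by positivity)] at this
  push_cast
  linarith

variable [MeasurableSpace F] [MeasurableSingletonClass F]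

/-- Gibbs' inequality. -/
lemma entOfObs_le_integral {μ : Measure X} [IsProbabilityMeasure μ] {g : X → F}
    (hg : Measurable g) {q : F → ℝ} (hq : ∀ a, 0 < q a) {Z : ℝ} (hZ : ∑ a, q a ≤ Z) :
    entOfObs μ g ≤ ∫ x, -logb 2 (q (g x)) ∂μ + logb 2 Z := by
  have hsum : ∑ a, μ.real (g ⁻¹' {a}) = 1 := by
    rw [sum_measureReal_preimage_singleton _ fun a _ => hg (measurableSet_singleton a)]
    simp
  have hZ0 : 0 < Z := by
    refine lt_of_lt_of_le ?_ hZ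
    refine Finset.sum_pos (fun a _ => hq a) ?_
    by_contra h
    rw [Finset.not_nonempty_iff_eq_empty] at h
    rw [h] at hsum
    simp at hsum
  have h2 : 0 < Real.log 2 := Real.log_pos (by norm_num)
  have hint : ∫ x, -logb 2 (q (g x)) ∂μ = ∑ a, μ.real (g ⁻¹' {a}) * -logb 2 (q a) := by
    rw [← integral_map (f := fun a => -logb 2 (q a)) hg.aemeasurable
      (measurable_of_finite _).aestronglyMeasurable]
    have := Measure.isProbabilityMeasure_map (μ := μ) hg.aemeasurable
    rw [integral_fintype Integrable.of_finite]
    refine Finset.sum_congr rfl fun a _ => ?_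
    rw [map_measureReal_apply hg (measurableSet_singleton a), smul_eq_mul]
  have key : ∀ a, -((μ (g ⁻¹' {a})).toReal * logb 2 (μ (g ⁻¹' {a})).toReal)
      ≤ μ.real (g ⁻¹' {a}) * -logb 2 (q a) + μ.real (g ⁻¹' {a}) * logb 2 Z
        + (q a / Z - μ.real (g ⁻¹' {a})) / Real.log 2 := by
    intro a
    change -(μ.real (g ⁻¹' {a}) * logb 2 (μ.real (g ⁻¹' {a}))) ≤ _
    have h0 : 0 ≤ μ.real (g ⁻¹' {a}) := measureReal_nonneg
    generalize μ.real (g ⁻¹' {a}) = p at h0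
    have hqa := hq a
    rcases h0.eq_or_lt with h | h
    · rw [← h]
      simp only [zero_mul, neg_zero, sub_zero, zero_add]
      positivity
    · have := Real.log_le_sub_one_of_pos (x := q a / (Z * p)) (by positivity)
      rw [Real.log_div hqa.ne' (by positivity), Real.log_mul hZ0.ne' h.ne'] at this
      have h3 : p * (Real.log (q a) - (Real.log Z + Real.log p)) ≤ q a / Z - p := by
        refine (mul_le_mul_of_nonneg_left this h.le).trans (le_of_eq ?_)
        field_simp
      simp only [logb]
      rw [← sub_nonneg]
      have : p * -(Real.log (q a) / Real.log 2) + p * (Real.log Z / Real.log 2)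
          + (q a / Z - p) / Real.log 2 - -(p * (Real.log p / Real.log 2))
          = ((q a / Z - p) - p * (Real.log (q a) - (Real.log Z + Real.log p))) / Real.log 2 := by
        ring
      rw [this]
      exact div_nonneg (by linarith) h2.le
  refine (Finset.sum_le_sum fun a _ => key a).trans ?_
  rw [Finset.sum_add_distrib, Finset.sum_add_distrib, ← hint, ← Finset.sum_mul, hsum, one_mul,
    ← Finset.sum_div, Finset.sum_sub_distrib, hsum, ← Finset.sum_div]
  have : (∑ a, q a) / Z ≤ 1 := (div_le_one hZ0).2 hZ
  have : ((∑ a, q a) / Z - 1) / Real.log 2 ≤ 0 := div_nonpos_of_nonpos_of_nonneg (by linarith) h2.le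
  linarith

lemma entOfObs_comp {μ : Measure X} {T : X → X} (hT : MeasurePreserving T μ μ) {g : X → F}
    (hg : Measurable g) : entOfObs μ (fun x => g (T x)) = entOfObs μ g := by
  unfold entOfObs
  refine Finset.sum_congr rfl fun a _ => ?_
  have : (fun x => g (T x)) ⁻¹' {a} = T ⁻¹' (g ⁻¹' {a}) := rfl
  rw [this, hT.measure_preimage (hg (measurableSet_singleton a)).nullMeasurableSet]

end Entropy

/-- Every finite-valued observable is approximated by one depending on finitely many
coordinates. -/
lemma exists_local_approx (μ : Measure Bin) [IsProbabilityMeasure μ] {k : ℕ} {f : Bin → Fin k}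
    (hf : Measurable f) {ε : ℝ} (hε : 0 < ε) :
    ∃ (m : ℕ) (f' : Bin → Fin k) (B : Set Bin), MeasurableSet B ∧ μ.real B ≤ ε ∧
      (∀ x ∉ B, f x = f' x) ∧
      ∀ x y : Bin, (∀ i : ℤ, -m ≤ i → i ≤ m → x i = y i) → f' x = f' y := by
  classical
  have : Nonempty (Fin k) := ⟨f fun _ => false⟩
  have hk : 0 < (k : ℝ) := by exact_mod_cast Fin.pos_iff_nonempty.2 this
  have hd : μ.MeasureDense (measurableCylinders fun _ : ℤ => Bool) :=
    Measure.MeasureDense.of_generateFrom_isSetAlgebra_finite μ isSetAlgebra_measurableCylinders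
      generateFrom_measurableCylinders.symm
  have hA : ∀ a : Fin k, MeasurableSet (f ⁻¹' {a}) := fun a => hf (measurableSet_singleton a)
  choose C hC hCμ using fun a : Fin k =>
    hd.approx (f ⁻¹' {a}) (hA a) (measure_ne_top _ _) (ε / k) (by positivity)
  have hCm : ∀ a, MeasurableSet (C a) := fun a => hd.measurable _ (hC a)
  choose s S _ hs using fun a => (mem_measurableCylinders _).1 (hC a)
  let f' : Bin → Fin k := fun x => if h : ∃ a, x ∈ C a then h.choose else Classical.arbitrary _
  refine ⟨(Finset.univ.biUnion s).sup Int.natAbs, f',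
    ⋃ a, symmDiff (f ⁻¹' {a}) (C a), MeasurableSet.iUnion fun a => (hA a).symmDiff (hCm a),
    ?_, ?_, ?_⟩
  · calc μ.real (⋃ a, symmDiff (f ⁻¹' {a}) (C a))
        ≤ ∑ a, μ.real (symmDiff (f ⁻¹' {a}) (C a)) := measureReal_iUnion_fintype_le _
      _ ≤ ∑ _a : Fin k, ε / k := Finset.sum_le_sum fun a _ => by
          refine ENNReal.toReal_le_of_le_ofReal (by positivity) (hCμ a).le
      _ = ε := by
          rw [Finset.sum_const, Finset.card_univ, Fintype.card_fin, nsmul_eq_mul]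
          field_simp
  · intro x hx
    simp only [Set.mem_iUnion, not_exists, Set.mem_symmDiff, Set.mem_preimage,
      Set.mem_singleton_iff, not_or, not_and, not_not] at hx
    have h : ∃ a, x ∈ C a := ⟨f x, (hx (f x)).1 rfl⟩
    change f x = dite _ _ _
    rw [dif_pos h]
    exact (hx _).2 h.choose_spec
  · intro x y hxy
    have : ∀ a, x ∈ C a ↔ y ∈ C a := by
      intro a
      rw [hs a, mem_cylinder, mem_cylinder]
      have : (s a).restrict x = (s a).restrict y := by
        funext i
        have hi : (i : ℤ).natAbs ≤ (Finset.univ.biUnion s).sup Int.natAbs :=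
          Finset.le_sup (Finset.mem_biUnion.2 ⟨a, Finset.mem_univ _, i.2⟩)
        exact hxy i (by omega) (by omega)
      rw [this]
    simp only [f', this]

lemma tendsto_logb_linear_div {D : ℝ} (hD : 0 < D) (m : ℕ) :
    Tendsto (fun n : ℕ => logb 2 (D * (n + m : ℕ)) / n) atTop (𝓝 0) := by
  have hy : Tendsto (fun n : ℕ => D * ((n + m : ℕ) : ℝ)) atTop atTop :=
    (tendsto_natCast_atTop_atTop.comp (tendsto_add_atTop_nat m)).const_mul_atTop hD
  have h1 := (Real.isLittleO_log_id_atTop.tendsto_div_nhds_zero.comp hy).mul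
    ((tendsto_const_nhds (x := D)).add (tendsto_const_div_atTop_nhds_zero_nat (D * m)))
  have h2 := h1.div_const (Real.log 2)
  rw [zero_mul, zero_div] at h2
  refine h2.congr' ?_
  filter_upwards [eventually_ge_atTop 1] with n hn
  have hn0 : (0 : ℝ) < n := by exact_mod_cast hn
  simp only [Function.comp, id, logb]
  push_cast
  have : (0 : ℝ) < n + m := by positivity
  field_simp

section UpperBound

variable {ψ : Bin → ℝ} {D : ℝ} {μ : Measure Bin}

lemma integral_birkhoffSum (hμ : InvProb shift μ) (hψ : Integrable ψ μ) (n : ℕ) :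
    Integrable (birkhoffSum shift ψ n) μ ∧ ∫ x, birkhoffSum shift ψ n x ∂μ = n * ∫ x, ψ x ∂μ := by
  have h : ∀ i, MeasurePreserving shift^[i] μ μ := fun i => hμ.2.iterate i
  have hi : ∀ i, Integrable (fun x => ψ (shift^[i] x)) μ := fun i =>
    ((h i).integrable_comp hψ.aestronglyMeasurable).2 hψ
  have he : ∀ i, ∫ x, ψ (shift^[i] x) ∂μ = ∫ x, ψ x ∂μ := fun i => by
    conv_rhs => rw [← (h i).map_eq]
    rw [integral_map (h i).measurable.aemeasurable]
    rw [(h i).map_eq]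
    exact hψ.aestronglyMeasurable
  refine ⟨integrable_finsetSum _ fun i _ => hi i, ?_⟩
  unfold birkhoffSum
  rw [integral_finsetSum _ fun i _ => hi i, Finset.sum_congr rfl fun i _ => he i,
    Finset.sum_const, Finset.card_range, nsmul_eq_mul]

/-- Entropy estimate at a fixed length. -/
lemma entObsT_le_of_length (hμ : InvProb shift μ) (hψ : Integrable ψ μ) (hZ : PartitionBound ψ D)
    {k : ℕ} {f f' : Bin → Fin k} (hf : Measurable f) {B : Set Bin} (hB : MeasurableSet B) {m : ℕ}
    (hff' : ∀ x ∉ B, f x = f' x)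
    (hloc : ∀ x y : Bin, (∀ i : ℤ, -m ≤ i → i ≤ m → x i = y i) → f' x = f' y)
    {η : ℝ} (hη : 0 < η) (hη1 : η < 1) {n : ℕ} (hn : 1 ≤ n) :
    n * entObsT shift μ f ≤ (n + 2 * m : ℕ) * (-∫ x, ψ x ∂μ)
      + n * (-logb 2 (1 - η) + μ.real B * logb 2 (k / η)) + logb 2 (D * (n + 2 * m : ℕ)) := by
  classical
  have := hμ.1
  have hk1 : 1 ≤ k := Fin.pos_iff_nonempty.2 ⟨f fun _ => false⟩
  have hk : (1 : ℝ) ≤ k := by exact_mod_cast hk1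
  have hk0 : (0 : ℝ) < k := by linarith
  set K := n + 2 * m with hK
  obtain ⟨q, hq, hqZ⟩ := hZ K (by omega)
  have hq0 : ∀ w, 0 < q w := fun w => by
    have := hq (ext w)
    rw [pre_ext] at this
    exact lt_of_lt_of_le (by positivity) this
  let κ : Fin k → Fin k → ℝ := fun a a' => if a = a' then 1 - η else η / k
  have hκ0 : ∀ a a', 0 < κ a a' := fun a a' => by
    simp only [κ]
    split_ifs
    · linarith
    · positivity
  have hκ1 : ∀ a', ∑ a, κ a a' ≤ 1 := fun a' => by
    calc ∑ a, κ a a' ≤ ∑ a, ((if a = a' then 1 - η else 0) + η / k) :=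
          Finset.sum_le_sum fun a _ => by
            simp only [κ]
            split_ifs
            · have : 0 < η / k := by positivity
              linarith
            · linarith
      _ = 1 := by
          rw [Finset.sum_add_distrib, Finset.sum_ite_eq' Finset.univ a', if_pos (Finset.mem_univ _),
            Finset.sum_const, Finset.card_univ, Fintype.card_fin, nsmul_eq_mul]
          field_simp
          ring
  let qn : (Fin n → Fin k) → ℝ := fun a =>
    ∑ w, q w * ∏ i, κ (a i) (f' (shift^[(i : ℕ) + m] (ext w)))
  have hqn_le : ∀ a w, q w * ∏ i : Fin n, κ (a i) (f' (shift^[(i : ℕ) + m] (ext w))) ≤ qn a :=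
    fun a w => Finset.single_le_sum
      (f := fun w => q w * ∏ i, κ (a i) (f' (shift^[(i : ℕ) + m] (ext w))))
      (fun w _ => mul_nonneg (hq0 w).le (Finset.prod_nonneg fun i _ => (hκ0 _ _).le))
      (Finset.mem_univ w)
  have hqn0 : ∀ a, 0 < qn a := fun a =>
    lt_of_lt_of_le (mul_pos (hq0 fun _ => false) (Finset.prod_pos fun i _ => hκ0 _ _))
      (hqn_le a fun _ => false)
  have hqnZ : ∑ a, qn a ≤ D * K := by
    refine le_trans ?_ hqZ
    simp only [qn]
    rw [Finset.sum_comm]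
    refine Finset.sum_le_sum fun w _ => ?_
    rw [← Finset.mul_sum]
    refine mul_le_of_le_one_right (hq0 w).le ?_
    have := Finset.prod_univ_sum (fun _ : Fin n => (Finset.univ : Finset (Fin k)))
      (fun i a => κ a (f' (shift^[(i : ℕ) + m] (ext w))))
    rw [Fintype.piFinset_univ] at this
    rw [← this]
    exact Finset.prod_le_one (fun i _ => Finset.sum_nonneg fun a _ => (hκ0 _ _).le)
      fun i _ => hκ1 _
  have hT : ∀ i, MeasurePreserving shift^[i] μ μ := fun i => hμ.2.iterate i
  let G : Bin → Fin n → Fin k := fun x i => f (shift^[(i : ℕ)] x)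
  have hG : Measurable G := measurable_pi_lambda _ fun i => hf.comp (hT i).measurable
  have hGm : Measurable fun x => G (shift^[m] x) := hG.comp (hT m).measurable
  have hL : 0 ≤ logb 2 (k / η) := Real.logb_nonneg (by norm_num) (by
    rw [le_div_iff₀ hη]; linarith)
  have hL1 : logb 2 (1 - η) ≤ 0 := Real.logb_nonpos (by norm_num) (by linarith) (by linarith)
  have hlogκ : ∀ y, logb 2 (1 - η) - B.indicator (fun _ => logb 2 (k / η)) y
      ≤ logb 2 (κ (f y) (f' y)) := fun y => by
    by_cases hy : y ∈ B
    · rw [Set.indicator_of_mem hy]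
      simp only [κ]
      split_ifs
      · linarith
      · rw [← inv_div (k : ℝ) η, Real.logb_inv]
        linarith
    · rw [Set.indicator_of_notMem hy]
      simp only [κ]
      rw [if_pos (hff' y hy), sub_zero]
  have hpt : ∀ x, -logb 2 (qn (G (shift^[m] x))) ≤ -birkhoffSum shift ψ K x
      + ∑ i : Fin n, (-logb 2 (1 - η)
        + B.indicator (fun _ => logb 2 (k / η)) (shift^[(i : ℕ) + m] x)) := by
    intro x
    have h1 : (2 : ℝ) ^ birkhoffSum shift ψ K x *
        ∏ i : Fin n, κ (f (shift^[(i : ℕ) + m] x)) (f' (shift^[(i : ℕ) + m] x))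
        ≤ qn (G (shift^[m] x)) := by
      refine le_trans ?_ (hqn_le _ (pre K x))
      have : ∀ i : Fin n, κ (G (shift^[m] x) i) (f' (shift^[(i : ℕ) + m] (ext (pre K x))))
          = κ (f (shift^[(i : ℕ) + m] x)) (f' (shift^[(i : ℕ) + m] x)) := by
        intro i
        have e1 : G (shift^[m] x) i = f (shift^[(i : ℕ) + m] x) := by
          simp only [G]
          rw [← Function.iterate_add_apply]
        have e2 : f' (shift^[(i : ℕ) + m] (ext (pre K x))) = f' (shift^[(i : ℕ) + m] x) := by
          apply hloc
          intro j hj1 hj2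
          rw [shift_iterate_apply, shift_iterate_apply]
          have := i.2
          exact ext_pre x (by push_cast; omega) (by push_cast; omega)
        rw [e1, e2]
      rw [Finset.prod_congr rfl fun i _ => this i]
      exact mul_le_mul_of_nonneg_right (hq x) (Finset.prod_nonneg fun i _ => (hκ0 _ _).le)
    have h2 := Real.logb_le_logb_of_le (b := 2) (by norm_num)
      (mul_pos (by positivity) (Finset.prod_pos fun i _ => hκ0 _ _)) h1
    rw [Real.logb_mul (by positivity) (Finset.prod_pos fun i _ => hκ0 _ _).ne',
      Real.logb_rpow (by norm_num) (by norm_num), Real.logb_prod _ _ fun i _ => (hκ0 _ _).ne'] at h2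
    have h3 := Finset.sum_le_sum fun (i : Fin n) (_ : i ∈ Finset.univ) =>
      hlogκ (shift^[(i : ℕ) + m] x)
    rw [Finset.sum_sub_distrib] at h3
    rw [Finset.sum_add_distrib, Finset.sum_neg_distrib]
    linarith
  have hb := integral_birkhoffSum hμ hψ K
  have hneg : Integrable (fun x => -birkhoffSum shift ψ K x) μ := hb.1.neg
  have hind : Integrable (B.indicator fun _ => logb 2 (k / η)) μ :=
    (integrable_const _).indicator hB
  have hci : ∀ i : Fin n, Integrable (fun x =>
      B.indicator (fun _ => logb 2 (k / η)) (shift^[(i : ℕ) + m] x)) μ := fun i =>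
    ((hT _).integrable_comp hind.aestronglyMeasurable).2 hind
  have hce : ∀ i : Fin n, ∫ x, B.indicator (fun _ => logb 2 (k / η)) (shift^[(i : ℕ) + m] x) ∂μ
      = μ.real B * logb 2 (k / η) := fun i => by
    have : ∫ x, B.indicator (fun _ => logb 2 (k / η)) (shift^[(i : ℕ) + m] x) ∂μ
        = ∫ x, B.indicator (fun _ => logb 2 (k / η)) x ∂μ := by
      conv_rhs => rw [← (hT ((i : ℕ) + m)).map_eq]
      rw [integral_map (hT _).measurable.aemeasurable]
      rw [(hT _).map_eq]
      exact hind.aestronglyMeasurable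
    rw [this, integral_indicator_const _ hB, smul_eq_mul]
  have hsi : ∀ i ∈ (Finset.univ : Finset (Fin n)), Integrable (fun x => -logb 2 (1 - η) +
      B.indicator (fun _ => logb 2 (k / η)) (shift^[(i : ℕ) + m] x)) μ := fun i _ =>
    (integrable_const _).add (hci i)
  have hmain := entOfObs_le_integral (μ := μ) hGm hqn0 hqnZ
  rw [entOfObs_comp (hT m) hG] at hmain
  have hent := entObsT_mul_le (μ := μ) shift f hn
  have hint : ∫ x, -logb 2 (qn (G (shift^[m] x))) ∂μ ≤ ∫ x, (-birkhoffSum shift ψ K x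
      + ∑ i : Fin n, (-logb 2 (1 - η)
        + B.indicator (fun _ => logb 2 (k / η)) (shift^[(i : ℕ) + m] x))) ∂μ := by
    refine integral_mono ?_ (hneg.add (integrable_finsetSum _ hsi)) hpt
    have : Integrable (fun a => -logb 2 (qn a)) (μ.map fun x => G (shift^[m] x)) :=
      Integrable.of_finite
    exact this.comp_measurable hGm
  rw [integral_add hneg (integrable_finsetSum _ hsi), integral_neg (birkhoffSum shift ψ K), hb.2,
    integral_finsetSum _ hsi] at hint
  have : ∀ i ∈ (Finset.univ : Finset (Fin n)), ∫ x, (-logb 2 (1 - η) +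
      B.indicator (fun _ => logb 2 (k / η)) (shift^[(i : ℕ) + m] x)) ∂μ
      = -logb 2 (1 - η) + μ.real B * logb 2 (k / η) := fun i _ => by
    rw [integral_add (integrable_const _) (hci i), hce i, integral_const]
    simp
  rw [Finset.sum_congr rfl this, Finset.sum_const, Finset.card_univ, Fintype.card_fin,
    nsmul_eq_mul] at hint
  linarith

theorem entObsT_le (hμ : InvProb shift μ) (hψ : Integrable ψ μ) (hD : 0 < D)
    (hZ : PartitionBound ψ D) {k : ℕ}
    {f : Bin → Fin k} (hf : Measurable f) : entObsT shift μ f ≤ -∫ x, ψ x ∂μ := by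
  have := hμ.1
  set A := -∫ x, ψ x ∂μ with hA
  have hk1 : 1 ≤ k := Fin.pos_iff_nonempty.2 ⟨f fun _ => false⟩
  have hk : (1 : ℝ) ≤ k := by exact_mod_cast hk1
  have step1 : ∀ η, 0 < η → η < 1 → ∀ ε, 0 < ε →
      entObsT shift μ f ≤ A - logb 2 (1 - η) + ε * logb 2 (k / η) := by
    intro η hη hη1 ε hε
    obtain ⟨m, f', B, hB, hBε, hff', hloc⟩ := exists_local_approx μ hf hε
    have hL : 0 ≤ logb 2 (k / η) := Real.logb_nonneg (by norm_num) (by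
      rw [le_div_iff₀ hη]; linarith)
    have lim : Tendsto (fun n : ℕ => A + 2 * m * A / n + (-logb 2 (1 - η) +
        μ.real B * logb 2 (k / η)) + logb 2 (D * (n + 2 * m : ℕ)) / n) atTop
        (𝓝 (A + 0 + (-logb 2 (1 - η) + μ.real B * logb 2 (k / η)) + 0)) :=
      (((tendsto_const_nhds.add (tendsto_const_div_atTop_nhds_zero_nat _)).add
        tendsto_const_nhds).add (tendsto_logb_linear_div hD (2 * m)))
    have hle := ge_of_tendsto lim (b := entObsT shift μ f) (by
      filter_upwards [eventually_ge_atTop 1] with n hn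
      have hn0 : (0 : ℝ) < n := by exact_mod_cast hn
      have := entObsT_le_of_length hμ hψ hZ hf hB hff' hloc hη hη1 hn
      rw [← hA, mul_comm, ← le_div_iff₀ hn0] at this
      refine this.trans (le_of_eq ?_)
      push_cast
      field_simp)
    have := mul_le_mul_of_nonneg_right hBε hL
    linarith
  have step2 : ∀ η, 0 < η → η < 1 → entObsT shift μ f ≤ A - logb 2 (1 - η) := by
    intro η hη hη1
    have lim : Tendsto (fun ε : ℝ => A - logb 2 (1 - η) + ε * logb 2 (k / η)) (𝓝[>] 0)
        (𝓝 (A - logb 2 (1 - η) + 0 * logb 2 (k / η))) :=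
      tendsto_nhdsWithin_of_tendsto_nhds (Continuous.tendsto (by fun_prop) _)
    rw [zero_mul, add_zero] at lim
    exact ge_of_tendsto lim (by
      filter_upwards [self_mem_nhdsWithin] with ε hε using step1 η hη hη1 ε hε)
  have lim : Tendsto (fun η : ℝ => A - logb 2 (1 - η)) (𝓝[>] 0) (𝓝 (A - logb 2 (1 - 0))) := by
    refine tendsto_nhdsWithin_of_tendsto_nhds (ContinuousAt.tendsto ?_)
    unfold logb
    fun_prop (disch := norm_num)
  rw [sub_zero, Real.logb_one, sub_zero] at lim
  exact ge_of_tendsto lim (by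
    filter_upwards [Ioo_mem_nhdsGT (zero_lt_one' ℝ)] with η hη using step2 η hη.1 hη.2)

theorem kolSinai_le (hμ : InvProb shift μ) (hψ : Integrable ψ μ) (hψ0 : ∀ x, ψ x ≤ 0) (hD : 0 < D)
    (hZ : PartitionBound ψ D) : kolSinai shift μ ≤ -∫ x, ψ x ∂μ := by
  have h0 : 0 ≤ -∫ x, ψ x ∂μ := neg_nonneg.2 (integral_nonpos hψ0)
  exact Real.iSup_le (fun k => Real.iSup_le (fun f => entObsT_le hμ hψ hD hZ f.2) h0) h0

theorem le_kolSinai (hμ : InvProb shift μ) (hψ : Integrable ψ μ) (hψ0 : ∀ x, ψ x ≤ 0) (hD : 0 < D)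
    (hZ : PartitionBound ψ D) {k : ℕ} {f : Bin → Fin k} (hf : Measurable f) :
    entObsT shift μ f ≤ kolSinai shift μ := by
  have h0 : 0 ≤ -∫ x, ψ x ∂μ := neg_nonneg.2 (integral_nonpos hψ0)
  have h1 : entObsT shift μ f ≤ ⨆ f : {f : Bin → Fin k // Measurable f}, entObsT shift μ f.1 :=
    le_ciSup (f := fun f : {f : Bin → Fin k // Measurable f} => entObsT shift μ f.1)
      ⟨_, by rintro _ ⟨f, rfl⟩; exact entObsT_le hμ hψ hD hZ f.2⟩ ⟨f, hf⟩
  refine h1.trans (le_ciSup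
    (f := fun k : ℕ => ⨆ f : {f : Bin → Fin k // Measurable f}, entObsT shift μ f.1)
    ⟨-∫ x, ψ x ∂μ, ?_⟩ k)
  rintro _ ⟨k, rfl⟩
  exact Real.iSup_le (fun f => entObsT_le hμ hψ hD hZ f.2) h0

end UpperBound

/-! ### The Bernoulli measure on a coded system -/

/-- The uniform measure on `Bool`. -/
def coin : Measure Bool := (PMF.uniformOfFintype Bool).toMeasure

instance : IsProbabilityMeasure coin := by unfold coin; infer_instance

lemma coin_singleton (a : Bool) : coin {a} = 2⁻¹ := by
  rw [coin, PMF.toMeasure_apply_singleton _ _ (measurableSet_singleton a)]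
  simp

/-- The law of independent fair coin flips indexed by `ℤ`. -/
def coinFlips : Measure Bin := Measure.infinitePi fun _ : ℤ => coin

instance : IsProbabilityMeasure coinFlips := by unfold coinFlips; infer_instance

lemma measurable_shift : Measurable shift := measurable_pi_lambda _ fun _ => measurable_pi_apply _

lemma map_shift_coinFlips : coinFlips.map shift = coinFlips := by
  have h := Measure.infinitePi_map_piCongrLeft (fun _ : ℤ => coin) (Equiv.addRight (-1 : ℤ))
  have he : (MeasurableEquiv.piCongrLeft (fun _ : ℤ => Bool) (Equiv.addRight (-1 : ℤ)) : Bin → Bin)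
      = shift := by
    funext x p
    have := Equiv.piCongrLeft_apply_apply (fun _ : ℤ => Bool) (Equiv.addRight (-1 : ℤ)) x (p + 1)
    simp only [Equiv.coe_addRight, add_neg_cancel_right] at this
    exact this
  rw [he] at h
  exact h

lemma coinFlips_cylinder (a : ℤ) (r : ℕ) (v : ℤ → Bool) :
    coinFlips {ω | ∀ j, a ≤ j → j < a + r → ω j = v j} = 2⁻¹ ^ r := by
  have : {ω : Bin | ∀ j, a ≤ j → j < a + r → ω j = v j}
      = Set.pi (Finset.Ico a (a + r) : Finset ℤ) fun j => {v j} := by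
    ext ω
    simp [Set.mem_pi]
  rw [this, coinFlips, Measure.infinitePi_pi _ fun j _ => measurableSet_singleton _]
  simp [coin_singleton]

lemma measurable_blk (M : ℕ) (t : ℤ) : Measurable (blk M t) :=
  measurable_pi_lambda _ fun p =>
    (measurable_of_finite fun a : Bool => xor a (decide ((p - t) % M = M - 1))).comp
      (measurable_pi_apply ((p - t) / M))

/-- The law of the concatenation of independent uniform blocks, starting at position `t`. -/
def blkLaw (M : ℕ) (t : ℤ) : Measure Bin := coinFlips.map (blk M t)

instance (M : ℕ) (t : ℤ) : IsProbabilityMeasure (blkLaw M t) :=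
  Measure.isProbabilityMeasure_map (measurable_blk M t).aemeasurable

lemma blkLaw_shift (M : ℕ) (t : ℤ) : (blkLaw M t).map shift = blkLaw M (t - 1) := by
  rw [blkLaw, Measure.map_map measurable_shift (measurable_blk M t), blkLaw]
  congr 1
  funext ω p
  have := blk_translate M (t - 1) ω p 1
  rw [sub_add_cancel] at this
  exact this

lemma blkLaw_period {M : ℕ} (hM : 0 < M) (t : ℤ) : blkLaw M (t - M) = blkLaw M t := by
  have hM' : (M : ℤ) ≠ 0 := by exact_mod_cast hM.ne'
  conv_rhs => rw [blkLaw, ← map_shift_coinFlips, Measure.map_map (measurable_blk M t)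
    measurable_shift]
  rw [blkLaw]
  congr 1
  funext ω p
  have e : p - (t - M) = (p - t) + 1 * (M : ℤ) := by ring
  simp only [Function.comp, blk, shift, e, Int.add_mul_ediv_right _ _ hM',
    Int.add_mul_emod_self_right]

lemma blkLaw_cylinder_le {M L r : ℕ} (hM : 0 < M) (hr : ∀ i < r, M * i < L) (t : ℤ)
    (w : Fin L → Bool) : blkLaw M t {x | pre L x = w} ≤ 2⁻¹ ^ r := by
  have hM' : (M : ℤ) ≠ 0 := by exact_mod_cast hM.ne'
  have hmeas : MeasurableSet {x : Bin | pre L x = w} :=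
    (measurable_pi_lambda (fun x : Bin => pre L x) fun i => measurable_pi_apply _)
      (measurableSet_singleton w)
  set a := (-t) / (M : ℤ) with ha
  rw [blkLaw, Measure.map_apply (measurable_blk M t) hmeas,
    ← coinFlips_cylinder a r fun j =>
      xor (ext w (M * (j - a))) (decide ((M * (j - a) - t) % M = M - 1))]
  refine measure_mono ?_
  rintro ω hω j hj1 hj2
  obtain ⟨i, rfl⟩ : ∃ i : ℕ, j = a + i := ⟨(j - a).toNat, by omega⟩
  have hi : M * i < L := hr i (by omega)
  have hp : (((M * i : ℕ) : ℤ) - t) / M = a + i := by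
    rw [show ((M * i : ℕ) : ℤ) - t = -t + i * M by push_cast; ring,
      Int.add_mul_ediv_right _ _ hM']
  have h1 : ext w ((M * i : ℕ) : ℤ) = blk M t ω ((M * i : ℕ) : ℤ) := by
    have : pre L (blk M t ω) = w := hω
    rw [← this]
    exact ext_pre _ (by positivity) (by exact_mod_cast hi)
  rw [add_sub_cancel_left, ← Nat.cast_mul, h1, blk, hp, Bool.xor_assoc, Bool.xor_self,
    Bool.xor_false]

/-- The average of the laws of concatenations of independent uniform blocks. -/
def blockBernoulli (M : ℕ) : Measure Bin := (M : ENNReal)⁻¹ • ∑ t ∈ Finset.range M, blkLaw M t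

lemma blockBernoulli_apply (M : ℕ) (s : Set Bin) :
    blockBernoulli M s = (M : ENNReal)⁻¹ * ∑ t ∈ Finset.range M, blkLaw M t s := by
  simp [blockBernoulli]

lemma blockBernoulli_le {M : ℕ} (hM : 0 < M) {s : Set Bin} {C : ENNReal}
    (h : ∀ t : ℤ, blkLaw M t s ≤ C) :
    blockBernoulli M s ≤ C := by
  rw [blockBernoulli_apply]
  calc (M : ENNReal)⁻¹ * ∑ t ∈ Finset.range M, blkLaw M t s
      ≤ (M : ENNReal)⁻¹ * ∑ _t ∈ Finset.range M, C := by gcongr; exact h _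
    _ = C := by
      rw [Finset.sum_const, Finset.card_range, nsmul_eq_mul, ← mul_assoc,
        ENNReal.inv_mul_cancel (by exact_mod_cast hM.ne') (ENNReal.natCast_ne_top M), one_mul]

lemma blockBernoulli_eq_one {M : ℕ} (hM : 0 < M) {s : Set Bin} (h : ∀ t : ℤ, blkLaw M t s = 1) :
    blockBernoulli M s = 1 := by
  rw [blockBernoulli_apply]
  simp only [h, Finset.sum_const, Finset.card_range, nsmul_eq_mul, mul_one]
  exact ENNReal.inv_mul_cancel (by exact_mod_cast hM.ne') (ENNReal.natCast_ne_top M)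

lemma invProb_blockBernoulli {M : ℕ} (hM : 0 < M) : InvProb shift (blockBernoulli M) := by
  refine ⟨⟨blockBernoulli_eq_one hM fun t => measure_univ⟩, measurable_shift, ?_⟩
  refine Measure.ext fun s hs => ?_
  rw [Measure.map_apply measurable_shift hs, blockBernoulli_apply, blockBernoulli_apply]
  congr 1
  have : ∀ t : ℤ, blkLaw M t (shift ⁻¹' s) = blkLaw M (t - 1) s := fun t => by
    rw [← blkLaw_shift, Measure.map_apply measurable_shift hs]
  simp only [this]
  obtain ⟨m, rfl⟩ : ∃ m, M = m + 1 := ⟨M - 1, by omega⟩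
  rw [Finset.sum_range_succ', Finset.sum_range_succ]
  congr 1
  · refine Finset.sum_congr rfl fun t _ => ?_
    push_cast
    rw [add_sub_cancel_right]
  · rw [← blkLaw_period hM m]
    congr 2
    push_cast
    ring

lemma le_entOfObs {X F : Type*} [MeasurableSpace X] [Fintype F] [MeasurableSpace F]
    [MeasurableSingletonClass F] {μ : Measure X} [IsProbabilityMeasure μ] {g : X → F}
    (hg : Measurable g) {r : ℕ} (h : ∀ a, μ (g ⁻¹' {a}) ≤ 2⁻¹ ^ r) : (r : ℝ) ≤ entOfObs μ g := by
  have hsum : ∑ a, μ.real (g ⁻¹' {a}) = 1 := by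
    rw [sum_measureReal_preimage_singleton _ fun a _ => hg (measurableSet_singleton a)]
    simp
  calc (r : ℝ) = ∑ a, μ.real (g ⁻¹' {a}) * r := by rw [← Finset.sum_mul, hsum, one_mul]
    _ ≤ _ := Finset.sum_le_sum fun a _ => ?_
  have h0 : 0 ≤ μ.real (g ⁻¹' {a}) := measureReal_nonneg
  have h1 : μ.real (g ⁻¹' {a}) ≤ (2 : ℝ) ^ (-(r : ℝ)) := by
    have := ENNReal.toReal_mono (by simp) (h a)
    rw [Real.rpow_neg (by norm_num), Real.rpow_natCast]
    simpa [measureReal_def] using this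
  change _ ≤ -(μ.real (g ⁻¹' {a}) * logb 2 (μ.real (g ⁻¹' {a})))
  generalize μ.real (g ⁻¹' {a}) = p at h0 h1
  rcases h0.eq_or_lt with h | h
  · simp [← h]
  · have := Real.logb_le_logb_of_le (b := 2) (by norm_num) h h1
    rw [Real.logb_rpow (by norm_num) (by norm_num)] at this
    rw [← mul_neg]
    exact mul_le_mul_of_nonneg_left (by linarith) h0

/-- The observable reading off the symbol at the origin. -/
def symb (x : Bin) : Fin 2 := if x 0 = true then 1 else 0

lemma measurable_symb : Measurable symb :=
  (measurable_of_finite fun a : Bool => if a = true then (1 : Fin 2) else 0).comp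
    (measurable_pi_apply (0 : ℤ))

lemma le_entObsT_blockBernoulli {M : ℕ} (hM : 0 < M) :
    1 / (M : ℝ) ≤ entObsT shift (blockBernoulli M) symb := by
  have hinv := invProb_blockBernoulli hM
  have := hinv.1
  have hM0 : (0 : ℝ) < M := by exact_mod_cast hM
  refine le_ciInf fun n => ?_
  set r := n / M + 1 with hr
  have hle : (r : ℝ) ≤ entOfObs (blockBernoulli M)
      (fun x => fun i : Fin (n + 1) => symb (shift^[(i : ℕ)] x)) := by
    refine le_entOfObs (measurable_pi_lambda _ fun i : Fin (n + 1) =>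
      measurable_symb.comp (hinv.2.iterate i).measurable) fun a => ?_
    refine blockBernoulli_le hM fun t => le_trans (measure_mono ?_)
      (blkLaw_cylinder_le (L := n + 1) (r := r) hM (fun i hi => ?_) t
        fun i : Fin (n + 1) => decide (a i = 1))
    · intro x hx
      have hx : (fun i : Fin (n + 1) => symb (shift^[(i : ℕ)] x)) = a := hx
      change pre (n + 1) x = _
      funext i
      rw [← hx]
      simp only [pre, symb, shift_iterate_apply, zero_add]
      cases x (i : ℕ) <;> simp
    · have : i ≤ n / M := by omega
      have := (Nat.le_div_iff_mul_le hM).1 this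
      rw [mul_comm]
      omega
  have hrM : ((n + 1 : ℕ) : ℝ) ≤ M * r := by
    have h1 := Nat.div_add_mod n M
    have h2 := Nat.mod_lt n hM
    have : n + 1 ≤ M * r := by rw [hr, mul_add]; omega
    exact_mod_cast this
  push_cast at hrM
  rw [div_le_div_iff₀ hM0 (by positivity), one_mul]
  nlinarith

lemma blockBernoulli_Xsub (n : ℕ) : blockBernoulli (2 ^ n) (Xsub n) = 1 := by
  refine blockBernoulli_eq_one (by positivity) fun t => ?_
  rw [blkLaw, Measure.map_apply (measurable_blk _ t) (isClosed_Xsub n).measurableSet]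
  have : blk (2 ^ n) t ⁻¹' Xsub n = Set.univ := Set.eq_univ_of_forall fun ω => blk_mem_Xsub n t ω
  rw [this, measure_univ]

/-! ### Pressure of the truncated potential -/

section Freezing

variable {α : ℝ} {N : ℕ} {β : ℕ → ℝ} {c1 : ℝ}

lemma integrable_phiFin (hα : 0 < α) (c : ℕ → ℝ)
    (hc : ∀ m n, 1 ≤ m → m ≤ n → n ≤ N + 1 → c m ≤ c n) (μ : Measure Bin)
    [IsProbabilityMeasure μ] : Integrable (phiFin α c N) μ := by
  refine Integrable.of_mem_Icc (c (N + 1) - 10 / α) (c (N + 1))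
    (measurable_phiFin N).aemeasurable (Eventually.of_forall fun x => ⟨?_, ?_⟩)
  · exact (le_phiN hα (N + 1) x).trans (phiN_le_phiFin (by omega) le_rfl x)
  · exact phiFin_le fun n h1 hn => (phiN_le hα n x).trans (hc n _ h1 hn le_rfl)

lemma phiFin_cseqFin_le (hα : 0 < α) (hβ : ∀ n, 1 ≤ n → n ≤ N → 0 < β n) (x : Bin) :
    phiFin α (cseqFin c1 β) N x ≤ cseqFin c1 β (N + 1) :=
  phiFin_le fun n h1 hn => (phiN_le hα n x).trans (cseqFin_mono hβ n _ h1 hn le_rfl)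

lemma phiFin_eq_iff (hα : 0 < α) (hβ : ∀ n, 1 ≤ n → n ≤ N → 0 < β n) (x : Bin) :
    phiFin α (cseqFin c1 β) N x = cseqFin c1 β (N + 1) ↔ x ∈ Xsub (N + 1) := by
  constructor
  · intro h
    by_contra hx
    obtain ⟨n, hn⟩ := Finite.exists_max
      fun n : Fin (N + 1) => phiN α (cseqFin c1 β) ((n : ℕ) + 1) x
    have h1 : phiFin α (cseqFin c1 β) N x ≤ phiN α (cseqFin c1 β) ((n : ℕ) + 1) x := ciSup_le hn
    rw [h] at h1
    rcases eq_or_ne (n : ℕ) N with e | e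
    · rw [e] at h1
      exact absurd (phiN_lt hα hx) (not_lt.2 h1)
    · have h2 := phiN_le (c := cseqFin c1 β) hα ((n : ℕ) + 1) x
      have h3 := cseqFin_lt (c1 := c1) hβ ((n : ℕ) + 1) (by omega) (by omega)
      linarith
  · intro hx
    refine le_antisymm (phiFin_cseqFin_le hα hβ x) ?_
    rw [← phiN_of_mem (α := α) (c := cseqFin c1 β) hx]
    exact phiN_le_phiFin (by omega) le_rfl x

lemma integral_phiFin_of_full (hα : 0 < α) (hβ : ∀ n, 1 ≤ n → n ≤ N → 0 < β n) {μ : Measure Bin}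
    [IsProbabilityMeasure μ] (hμ : μ (Xsub (N + 1)) = 1) :
    ∫ x, phiFin α (cseqFin c1 β) N x ∂μ = cseqFin c1 β (N + 1) := by
  have h : ∀ᵐ x ∂μ, x ∈ Xsub (N + 1) :=
    (mem_ae_iff_prob_eq_one (isClosed_Xsub _).measurableSet).2 hμ
  rw [integral_congr_ae (g := fun _ => cseqFin c1 β (N + 1))
    (h.mono fun x hx => (phiFin_eq_iff hα hβ x).2 hx), integral_const]
  simp

lemma full_of_integral_phiFin (hα : 0 < α) (hβ : ∀ n, 1 ≤ n → n ≤ N → 0 < β n) {μ : Measure Bin}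
    [IsProbabilityMeasure μ]
    (hμ : cseqFin c1 β (N + 1) ≤ ∫ x, phiFin α (cseqFin c1 β) N x ∂μ) :
    μ (Xsub (N + 1)) = 1 := by
  refine (mem_ae_iff_prob_eq_one (isClosed_Xsub _).measurableSet).1 ?_
  have hint := integrable_phiFin hα (cseqFin c1 β) (cseqFin_mono hβ) μ
  have hsub : Integrable (fun x => cseqFin c1 β (N + 1) - phiFin α (cseqFin c1 β) N x) μ :=
    (integrable_const _).sub hint
  have h0 : 0 ≤ fun x => cseqFin c1 β (N + 1) - phiFin α (cseqFin c1 β) N x := fun x =>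
    sub_nonneg.2 (phiFin_cseqFin_le hα hβ x)
  have hi : ∫ x, (cseqFin c1 β (N + 1) - phiFin α (cseqFin c1 β) N x) ∂μ = 0 := by
    refine le_antisymm ?_ (integral_nonneg h0)
    rw [integral_sub (integrable_const _) hint, integral_const]
    simpa using hμ
  filter_upwards [(integral_eq_zero_iff_of_nonneg h0 hsub).1 hi] with x hx
  exact (phiFin_eq_iff hα hβ x).1 (sub_eq_zero.1 hx).symm

/-- Variational upper bound for inverse temperatures at least `β_N`. -/
lemma kolSinai_add_integral_le (hα : 0 < α) (hβ : ∀ n, 1 ≤ n → n ≤ N → 0 < β n) {b : ℝ}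
    (hαb : α ≤ b) (hb : ∀ n, 1 ≤ n → n ≤ N → β n ≤ b) {μ : Measure Bin} (hμ : InvProb shift μ) :
    kolSinai shift μ + b * ∫ x, phiFin α (cseqFin c1 β) N x ∂μ
      ≤ (1 / 2) ^ (N + 1) + b * cseqFin c1 β (N + 1) ∧
    ∀ {k : ℕ} {f : Bin → Fin k}, Measurable f → entObsT shift μ f ≤ kolSinai shift μ := by
  have := hμ.1
  have hint := integrable_phiFin hα (cseqFin c1 β) (cseqFin_mono hβ) μ
  set P := (1 / 2 : ℝ) ^ (N + 1) + b * cseqFin c1 β (N + 1) with hP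
  have hψ : Integrable (fun x => b * phiFin α (cseqFin c1 β) N x - P) μ :=
    (hint.const_mul b).sub (integrable_const _)
  have hψ0 : ∀ x, b * phiFin α (cseqFin c1 β) N x - P ≤ 0 := fun x => by
    have h1 := mul_le_mul_of_nonneg_left (phiFin_cseqFin_le (c1 := c1) hα hβ x)
      (hα.le.trans hαb)
    have h2 : (0 : ℝ) < (1 / 2) ^ (N + 1) := by positivity
    linarith
  have hZ := partitionBound_phiFin hα hαb (cseqFin_mono hβ) (cseqFin_pressure (c1 := c1) hβ hb)
  refine ⟨?_, fun hf => le_kolSinai hμ hψ hψ0 (by norm_num) hZ hf⟩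
  have h := kolSinai_le hμ hψ hψ0 (by norm_num) hZ
  rw [integral_sub (hint.const_mul b) (integrable_const _), integral_const_mul, integral_const]
    at h
  simp only [probReal_univ, one_smul] at h
  linarith

end Freezing

/-- ultimate freezing in the finite case. -/
theorem finite_freezing (α : ℝ) (hα : 0 < α) (N : ℕ) (hN : 1 ≤ N) (β : ℕ → ℝ)
    (h1 : α < β 1) (hmono : ∀ n : ℕ, 1 ≤ n → n < N → β n < β (n + 1))
    (c1 : ℝ) (μmax : Measure Bin)
    (hmax : IsMaxEntropyOn (Xsub (N + 1)) μmax)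
    (huniq : ∀ ν : Measure Bin, IsMaxEntropyOn (Xsub (N + 1)) ν → ν = μmax)
    (b : ℝ) (hb : β N < b) :
    ∀ μ : Measure Bin,
      IsEquilibrium shift (fun x => b * phiFin α (cseqFin c1 β) N x) μ ↔ μ = μmax := by
  have hβα : ∀ n, 1 ≤ n → n ≤ N → α < β n := fun n hn => by
    induction n, hn using Nat.le_induction with
    | base => exact fun _ => h1
    | succ n hn ih => exact fun h => (ih (by omega)).trans (hmono n hn (by omega))
  have hβN : ∀ n, 1 ≤ n → n ≤ N → β n ≤ β N := fun n hn hnN => by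
    induction N, hnN using Nat.le_induction with
    | base => exact le_rfl
    | succ m hm ih =>
      exact (Nat.decreasingInduction' (P := fun j => 1 ≤ j → β j ≤ β (m + 1))
        (fun j hj _ h h' => (hmono j h' (by omega)).le.trans (h (by omega)))
        (by omega : n ≤ m + 1) (fun _ => le_rfl)) hn
  have hβ : ∀ n, 1 ≤ n → n ≤ N → 0 < β n := fun n hn hnN => hα.trans (hβα n hn hnN)
  have hαN := hβα N hN le_rfl
  have hupper : ∀ {b' : ℝ}, β N ≤ b' → ∀ {μ : Measure Bin}, InvProb shift μ →
      kolSinai shift μ + b' * ∫ x, phiFin α (cseqFin c1 β) N x ∂μ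
        ≤ (1 / 2) ^ (N + 1) + b' * cseqFin c1 β (N + 1) := fun hb' _ hμ =>
    (kolSinai_add_integral_le hα hβ (hαN.le.trans hb')
      (fun n hn hnN => (hβN n hn hnN).trans hb') hμ).1
  have hpos : 0 < 2 ^ (N + 1) := by positivity
  have hν := invProb_blockBernoulli hpos
  have hent : (1 / 2 : ℝ) ^ (N + 1) ≤ kolSinai shift μmax := by
    refine le_trans ?_ (hmax.2.2 _ hν (blockBernoulli_Xsub _))
    refine le_trans (le_of_eq ?_) ((le_entObsT_blockBernoulli hpos).trans
      ((kolSinai_add_integral_le (c1 := c1) hα hβ hαN.le hβN hν).2 measurable_symb))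
    push_cast
    rw [one_div_pow]
  have := hmax.1.1
  have hmaxval : kolSinai shift μmax + ∫ x, b * phiFin α (cseqFin c1 β) N x ∂μmax
      = (1 / 2) ^ (N + 1) + b * cseqFin c1 β (N + 1) := by
    have h := hupper hb.le hmax.1
    rw [integral_const_mul]
    refine le_antisymm h ?_
    rw [integral_phiFin_of_full hα hβ hmax.2.1]
    linarith
  have hpress : pressure shift (fun x => b * phiFin α (cseqFin c1 β) N x)
      = (1 / 2) ^ (N + 1) + b * cseqFin c1 β (N + 1) := by
    have hle : ∀ μ : {μ : Measure Bin // InvProb shift μ},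
        kolSinai shift μ.1 + ∫ x, b * phiFin α (cseqFin c1 β) N x ∂μ.1
          ≤ (1 / 2) ^ (N + 1) + b * cseqFin c1 β (N + 1) := fun μ => by
      rw [integral_const_mul]
      exact hupper hb.le μ.2
    have : Nonempty {μ : Measure Bin // InvProb shift μ} := ⟨⟨μmax, hmax.1⟩⟩
    refine le_antisymm (ciSup_le hle) ?_
    rw [← hmaxval]
    exact le_ciSup (f := fun μ : {μ : Measure Bin // InvProb shift μ} =>
      kolSinai shift μ.1 + ∫ x, b * phiFin α (cseqFin c1 β) N x ∂μ.1)
      ⟨_, by rintro _ ⟨μ, rfl⟩; exact hle μ⟩ ⟨μmax, hmax.1⟩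
  intro μ
  constructor
  · rintro ⟨hμ, heq⟩
    have := hμ.1
    rw [hpress, integral_const_mul] at heq
    have hmid := hupper (b' := (β N + b) / 2) (by linarith) hμ
    have hge : cseqFin c1 β (N + 1) ≤ ∫ x, phiFin α (cseqFin c1 β) N x ∂μ := by
      by_contra! hlt
      nlinarith
    have hfull := full_of_integral_phiFin hα hβ hge
    rw [integral_phiFin_of_full hα hβ hfull] at heq
    have hmaxle := hupper hb.le hmax.1
    rw [integral_phiFin_of_full hα hβ hmax.2.1] at hmaxle
    exact huniq μ ⟨hμ, hfull, fun ν hν' hνX => (hmax.2.2 ν hν' hνX).trans (by linarith)⟩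
  · rintro rfl
    exact ⟨hmax.1, hmaxval.trans hpress.symm⟩

end PhaseTransitions
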